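/- Let T be an operator assigning to each m-tuple of bounded compactly supported measurable functions on ℝ^d a measurable function, and suppose T satisfies sparse form domination with constant C_T. Let p⃗ ∈ [1,∞]^m, let p be given by 1/p = Σ_{j=1}^m 1/p_j, assume p ≥ 1, and let w⃗ ∈ A_{p⃗} with w := ∏_{j=1}^m w_j. Then there is a constant c, depending only on d, m, p⃗ and C_T, such that for all f_1,…,f_m for which each f_j w_j^{-1} is bounded and compactly supported, one has sup_{λ>0} λ · |{x ∈ ℝ^d : |T(f_1 w_1^{-1},…,f_m w_m^{-1})(x)| · w(x) > λ}|^{1/p} ≤ c · [w^p]_FW · [w⃗]_{p⃗} · ∏_{j=1}^m ‖f_j‖_{L^{p_j}(ℝ^d)}. -/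

import Mathlib

open MeasureTheory ENNReal Set

noncomputable section

namespace Paper

variable {d m : ℕ}

abbrev Rd (d : ℕ) := Fin d → ℝ

structure Cube (d : ℕ) where
  corner : Rd d
  side : ℝ
  side_pos : 0 < side

def Cube.set (Q : Cube d) : Set (Rd d) :=
  {x | ∀ i, Q.corner i ≤ x i ∧ x i < Q.corner i + Q.side}

/-- the average `⟨f⟩_{q,Q}` for finite exponent `q`, of an `ℝ≥0∞`-valued function -/
def eAvg (f : Rd d → ℝ≥0∞) (q : ℝ) (Q : Cube d) : ℝ≥0∞ :=
  ((volume Q.set)⁻¹ * ∫⁻ x in Q.set, f x ^ q) ^ (1 / q)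

def ofFn (f : Rd d → ℝ) : Rd d → ℝ≥0∞ := fun x => ENNReal.ofReal |f x|

/-- the average `⟨f⟩_{q,Q}` for finite exponent `q > 0` -/
def avg (f : Rd d → ℝ) (q : ℝ) (Q : Cube d) : ℝ≥0∞ := eAvg (ofFn f) q Q

/-- the average `⟨f⟩_{q,Q}` for exponent `q ∈ (0,∞]` -/
def avgE (f : Rd d → ℝ) (q : ℝ≥0∞) (Q : Cube d) : ℝ≥0∞ :=
  if q = ∞ then essSup (ofFn f) (volume.restrict Q.set) else avg f q.toReal Q

def IsWeight (u : Rd d → ℝ) : Prop :=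
  MeasureTheory.LocallyIntegrable u volume ∧ ∀ᵐ x ∂(volume : Measure (Rd d)), 0 < u x

/-- `u(A) = ∫_A u dx` -/
def wMeas (u : Rd d → ℝ) (A : Set (Rd d)) : ℝ≥0∞ := ∫⁻ x in A, ENNReal.ofReal (u x)

/-- the Hardy–Littlewood maximal operator -/
def maximal (f : Rd d → ℝ) (x : Rd d) : ℝ≥0∞ :=
  ⨆ (Q : Cube d) (_ : x ∈ Q.set), avg f 1 Q

/-- the Fujii–Wilson constant `[u]_FW` -/
def FW (u : Rd d → ℝ) : ℝ≥0∞ :=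
  ⨆ Q : Cube d, (wMeas u Q.set)⁻¹ * ∫⁻ x in Q.set, maximal (Q.set.indicator u) x

/-- Hölder conjugate in `ℝ≥0∞` -/
def conj (q : ℝ≥0∞) : ℝ≥0∞ := (1 - q⁻¹)⁻¹

def prodW (w : Fin m → Rd d → ℝ) : Rd d → ℝ := fun x => ∏ j, w j x

/-- the two-weight multilinear Muckenhoupt constant `[w⃗,ω]_{p⃗}`; here `p0` is the
real number with `1/p0 = ∑ 1/p j`. -/
def APtw (p0 : ℝ) (p : Fin m → ℝ≥0∞) (w : Fin m → Rd d → ℝ) (ω : Rd d → ℝ) : ℝ≥0∞ :=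
  ⨆ Q : Cube d, avg ω p0 Q * ∏ j, avgE (fun x => (w j x)⁻¹) (conj (p j)) Q

/-- the multilinear Muckenhoupt constant `[w⃗]_{p⃗}` -/
def AP (p0 : ℝ) (p : Fin m → ℝ≥0∞) (w : Fin m → Rd d → ℝ) : ℝ≥0∞ :=
  APtw p0 p w (prodW w)

def IsSparse (η : ℝ) (S : Set (Cube d)) : Prop :=
  ∃ E : Cube d → Set (Rd d),
    (∀ Q ∈ S, E Q ⊆ Q.set ∧ MeasurableSet (E Q) ∧
      ENNReal.ofReal η * volume Q.set ≤ volume (E Q)) ∧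
    S.PairwiseDisjoint E

def dyadicGrid (d : ℕ) (α : Rd d) : Set (Cube d) :=
  {Q | ∃ (j : ℤ) (k : Fin d → ℤ),
    Q.side = (2:ℝ) ^ (-j) ∧ ∀ i, Q.corner i = (2:ℝ) ^ (-j) * (α i + k i)}

def IsDyadicGrid (D : Set (Cube d)) : Prop :=
  ∃ α : Rd d, (∀ i, α i = 0 ∨ α i = 1/3 ∨ α i = 2/3) ∧ D = dyadicGrid d α

/-- bounded, compactly supported, measurable -/
def BCS (f : Rd d → ℝ) : Prop :=
  Measurable f ∧ (∃ C, ∀ x, |f x| ≤ C) ∧ HasCompactSupport f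

def sparseForm (S : Set (Cube d)) (f : Fin m → Rd d → ℝ) (g : Rd d → ℝ) : ℝ≥0∞ :=
  ∑' Q : S, (∏ j, avg (f j) 1 Q.1) * avg g 1 Q.1 * volume (Q.1).set

def SparseFormDom (T : (Fin m → Rd d → ℝ) → Rd d → ℝ) (CT : ℝ≥0∞) : Prop :=
  ∀ (f : Fin m → Rd d → ℝ) (g : Rd d → ℝ), (∀ j, BCS (f j)) → BCS g →
    ∃ S : Set (Cube d), IsSparse (1/2) S ∧
      (∫⁻ x, ofFn (T f) x * ofFn g x) ≤ CT * sparseForm S f g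

/-- `‖f‖_{L^{p,∞}_u} = sup_{λ>0} λ (u^p({f > λ}))^{1/p}` for `ℝ≥0∞`-valued `f` -/
def eWeakNorm (u : Rd d → ℝ) (p : ℝ) (f : Rd d → ℝ≥0∞) : ℝ≥0∞ :=
  ⨆ (l : ℝ) (_ : 0 < l), ENNReal.ofReal l *
    (∫⁻ x in {x | ENNReal.ofReal l < f x}, ENNReal.ofReal (u x) ^ p) ^ (1/p)

def weakNorm (u : Rd d → ℝ) (p : ℝ) (f : Rd d → ℝ) : ℝ≥0∞ := eWeakNorm u p (ofFn f)

/-- `‖f‖_{L^p_u} = ‖fu‖_{L^p}` -/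
def LpW (u : Rd d → ℝ) (p : ℝ≥0∞) (f : Rd d → ℝ) : ℝ≥0∞ :=
  eLpNorm (fun x => f x * u x) p volume

theorem Cube.set_eq_pi (Q : Cube d) :
    Q.set = Set.pi univ fun i => Ico (Q.corner i) (Q.corner i + Q.side) := by
  ext x; simp [Cube.set]

theorem Cube.measurableSet (Q : Cube d) : MeasurableSet Q.set := by
  rw [Q.set_eq_pi]
  exact MeasurableSet.univ_pi fun _ => measurableSet_Ico

theorem Cube.volume_eq (Q : Cube d) : volume Q.set = ENNReal.ofReal Q.side ^ d := by
  rw [Q.set_eq_pi, Real.volume_pi_Ico]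
  simp

theorem Cube.volume_ne_zero (Q : Cube d) : volume Q.set ≠ 0 := by
  rw [Q.volume_eq]
  exact pow_ne_zero _ (by simpa using Q.side_pos)

theorem Cube.volume_ne_top (Q : Cube d) : volume Q.set ≠ ∞ := by
  rw [Q.volume_eq]
  exact ENNReal.pow_ne_top ENNReal.ofReal_ne_top

/-- The centre of a cube. -/
def Cube.center (Q : Cube d) : Rd d := fun i => Q.corner i + Q.side / 2

theorem Cube.closedBall_eq (Q : Cube d) :
    Metric.closedBall Q.center (Q.side / 2) =
      Set.pi univ fun i => Icc (Q.corner i) (Q.corner i + Q.side) := by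
  rw [closedBall_pi _ (by linarith [Q.side_pos])]
  congr 1
  ext i y
  simp only [Cube.center, Metric.mem_closedBall, Real.dist_eq, abs_le, mem_Icc]
  constructor <;> rintro ⟨h1, h2⟩ <;> constructor <;> linarith

theorem Cube.ae_eq_closedBall (Q : Cube d) :
    Q.set =ᵐ[volume] Metric.closedBall Q.center (Q.side / 2) := by
  rw [Q.closedBall_eq, Q.set_eq_pi, Set.pi_univ_Icc]
  exact Measure.univ_pi_Ico_ae_eq_Icc

theorem Cube.subset_closedBall (Q : Cube d) :
    Q.set ⊆ Metric.closedBall Q.center (Q.side / 2) := by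
  rw [Q.closedBall_eq, Q.set_eq_pi]
  exact Set.pi_mono fun i _ => Ico_subset_Icc_self

theorem Cube.volume_enlarged (Q : Cube d) :
    volume (Metric.closedBall Q.center (5 * (Q.side / 2))) = 5 ^ d * volume Q.set := by
  have h := Q.side_pos
  rw [Real.volume_pi_closedBall _ (by linarith), Q.volume_eq, Fintype.card_fin,
    ← ENNReal.ofReal_pow h.le, show 2 * (5 * (Q.side / 2)) = 5 * Q.side by ring, mul_pow,
    ENNReal.ofReal_mul (by positivity), ENNReal.ofReal_pow (by norm_num)]
  norm_num

/-- Weak-type covering bound for a family of cubes of bounded side length. -/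
theorem mul_volume_iUnion_cube_le (F : Set (Cube d)) (R : ℝ) (hR : ∀ Q ∈ F, Q.side ≤ R)
    (H : Rd d → ℝ≥0∞) (c : ℝ≥0∞) (hF : ∀ Q ∈ F, c * volume Q.set ≤ ∫⁻ x in Q.set, H x) :
    c * volume (⋃ Q ∈ F, Q.set) ≤ 5 ^ d * ∫⁻ x in ⋃ Q ∈ F, Q.set, H x := by
  obtain ⟨u, huF, hdisj, hcov⟩ := Vitali.exists_disjoint_subfamily_covering_enlargement_closedBall
    F (fun Q => Q.center) (fun Q => Q.side / 2) (R / 2) (fun Q hQ => by linarith [hR Q hQ]) 5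
    (by norm_num)
  have hcount : u.Countable := hdisj.countable_of_nonempty_interior fun Q _ =>
    ⟨Q.center, Metric.ball_subset_interior_closedBall
      (Metric.mem_ball_self (by linarith [Q.side_pos]))⟩
  have hdisj' : u.PairwiseDisjoint Cube.set := fun P hP Q hQ hPQ =>
    (hdisj hP hQ hPQ).mono P.subset_closedBall Q.subset_closedBall
  calc c * volume (⋃ Q ∈ F, Q.set)
      ≤ c * volume (⋃ Q ∈ u, Metric.closedBall Q.center (5 * (Q.side / 2))) := by
        gcongr c * volume ?_
        refine iUnion₂_subset fun Q hQ => ?_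
        obtain ⟨b, hb, hsub⟩ := hcov Q hQ
        exact Q.subset_closedBall.trans (hsub.trans (subset_biUnion_of_mem (u := fun Q : Cube d =>
          Metric.closedBall Q.center (5 * (Q.side / 2))) hb))
    _ ≤ c * ∑' Q : u, volume (Metric.closedBall Q.1.center (5 * (Q.1.side / 2))) := by
        gcongr
        exact measure_biUnion_le _ hcount _
    _ = 5 ^ d * ∑' Q : u, c * volume Q.1.set := by
        simp_rw [Cube.volume_enlarged, ENNReal.tsum_mul_left]
        ring
    _ ≤ 5 ^ d * ∑' Q : u, ∫⁻ x in Q.1.set, H x := by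
        gcongr with Q
        exact hF Q.1 (huF Q.2)
    _ = 5 ^ d * ∫⁻ x in ⋃ Q ∈ u, Q.set, H x := by
        rw [lintegral_biUnion hcount (fun Q _ => Q.measurableSet) hdisj']
    _ ≤ 5 ^ d * ∫⁻ x in ⋃ Q ∈ F, Q.set, H x := by
        gcongr 5 ^ d * ?_
        exact lintegral_mono_set (biUnion_subset_biUnion_left huF)

theorem IsSparse.sum_volume_le {S : Set (Cube d)} (hS : IsSparse (1 / 2) S)
    (F : Finset (Cube d)) (hF : ∀ Q ∈ F, Q ∈ S) :
    ∑ Q ∈ F, volume Q.set ≤ 2 * volume (⋃ Q ∈ F, Q.set) := by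
  obtain ⟨E, hE, hdisj⟩ := hS
  calc ∑ Q ∈ F, volume Q.set ≤ ∑ Q ∈ F, 2 * volume (E Q) := by
        refine Finset.sum_le_sum fun Q hQ => ?_
        have h := (hE Q (hF Q hQ)).2.2
        calc volume Q.set = 2 * (ENNReal.ofReal (1 / 2) * volume Q.set) := by
              rw [← mul_assoc, one_div, ENNReal.ofReal_inv_of_pos (by norm_num),
                ENNReal.ofReal_ofNat, ENNReal.mul_inv_cancel (by norm_num) (by norm_num), one_mul]
          _ ≤ _ := by gcongr
    _ = 2 * volume (⋃ Q ∈ F, E Q) := by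
        rw [← Finset.mul_sum, measure_biUnion_finset (fun P hP Q hQ h =>
          hdisj (hF P hP) (hF Q hQ) h) fun Q hQ => (hE Q (hF Q hQ)).2.1]
    _ ≤ _ := by
        gcongr with Q hQ
        exact (hE Q (hF Q hQ)).1

/-- Weak-type bound for a finite sparse family. -/
theorem IsSparse.mul_sum_volume_le {S : Set (Cube d)} (hS : IsSparse (1 / 2) S)
    (F : Finset (Cube d)) (hF : ∀ Q ∈ F, Q ∈ S) (H : Rd d → ℝ≥0∞) (c : ℝ≥0∞)
    (hc : ∀ Q ∈ F, c * volume Q.set ≤ ∫⁻ x in Q.set, H x) :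
    c * ∑ Q ∈ F, volume Q.set ≤ 2 * 5 ^ d * ∫⁻ x, H x := by
  obtain ⟨R, hR⟩ : ∃ R : ℝ, ∀ Q ∈ (F : Set (Cube d)), Q.side ≤ R := by
    obtain ⟨R, hR⟩ := (F.finite_toSet.image Cube.side).bddAbove
    exact ⟨R, fun Q hQ => hR (mem_image_of_mem _ hQ)⟩
  calc c * ∑ Q ∈ F, volume Q.set ≤ c * (2 * volume (⋃ Q ∈ F, Q.set)) := by
        gcongr
        exact hS.sum_volume_le F hF
    _ = 2 * (c * volume (⋃ Q ∈ (F : Set (Cube d)), Q.set)) := by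
        simp only [Finset.mem_coe]
        ring
    _ ≤ 2 * (5 ^ d * ∫⁻ x in ⋃ Q ∈ (F : Set (Cube d)), Q.set, H x) := by
        gcongr 2 * ?_
        exact mul_volume_iUnion_cube_le _ R hR H c hc
    _ ≤ 2 * (5 ^ d * ∫⁻ x, H x) := by
        gcongr
        exact Measure.restrict_le_self
    _ = _ := by ring

/-- The dyadic child of `Q` containing the point `x ∈ Q`. -/
def Cube.child (Q : Cube d) (x : Rd d) : Cube d where
  corner i := if x i < Q.corner i + Q.side / 2 then Q.corner i else Q.corner i + Q.side / 2
  side := Q.side / 2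
  side_pos := half_pos Q.side_pos

/-- The dyadic subcube of `Q` of generation `n` containing the point `x ∈ Q`. -/
def Cube.cell (Q : Cube d) : ℕ → Rd d → Cube d
  | 0, _ => Q
  | n + 1, x => (Q.cell n x).child x

theorem Cube.mem_child {Q : Cube d} {x : Rd d} (hx : x ∈ Q.set) : x ∈ (Q.child x).set := by
  intro i
  have := hx i
  simp only [Cube.child]
  split_ifs with h <;> constructor <;> linarith

theorem Cube.child_subset (Q : Cube d) (x : Rd d) : (Q.child x).set ⊆ Q.set := by
  intro y hy i
  have := hy i
  have hs := Q.side_pos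
  simp only [Cube.child] at this
  split_ifs at this with h <;> constructor <;> linarith

theorem Cube.child_eq_of_mem {Q : Cube d} {x y : Rd d} (hy : y ∈ (Q.child x).set) :
    Q.child y = Q.child x := by
  simp only [Cube.child, Cube.mk.injEq, and_true]
  ext i
  have := hy i
  simp only [Cube.child] at this
  split_ifs at this ⊢ with h1 h2 <;> first | rfl | (exfalso; linarith)

theorem Cube.mem_cell {Q : Cube d} {x : Rd d} (hx : x ∈ Q.set) (n : ℕ) :
    x ∈ (Q.cell n x).set := by
  induction n with
  | zero => exact hx
  | succ n ih => exact mem_child ih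

theorem Cube.cell_antitone (Q : Cube d) (x : Rd d) : Antitone fun n => (Q.cell n x).set :=
  antitone_nat_of_succ_le fun n => (Q.cell n x).child_subset x

theorem Cube.cell_subset (Q : Cube d) (n : ℕ) (x : Rd d) : (Q.cell n x).set ⊆ Q.set :=
  Q.cell_antitone x (Nat.zero_le n)

theorem Cube.cell_eq_of_mem {Q : Cube d} {n : ℕ} {x y : Rd d} (hy : y ∈ (Q.cell n x).set) :
    Q.cell n y = Q.cell n x := by
  induction n with
  | zero => rfl
  | succ n ih =>
    have h := ih ((Q.cell n x).child_subset x hy)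
    simp only [Cube.cell]
    rw [h]
    exact child_eq_of_mem hy

theorem Cube.cell_side (Q : Cube d) (n : ℕ) (x : Rd d) : (Q.cell n x).side = Q.side / 2 ^ n := by
  induction n with
  | zero => simp [Cube.cell]
  | succ n ih => simp only [Cube.cell, Cube.child, ih]; field_simp; ring

theorem Cube.volume_child (Q : Cube d) (x : Rd d) :
    volume Q.set = 2 ^ d * volume (Q.child x).set := by
  rw [Cube.volume_eq, Cube.volume_eq, ← mul_pow]
  congr 1
  rw [← ENNReal.ofReal_ofNat 2, ← ENNReal.ofReal_mul (by norm_num)]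
  simp only [Cube.child]
  congr 1
  ring

/-- The average of `U` over `Q`. -/
def mean (U : Rd d → ℝ≥0∞) (Q : Cube d) : ℝ≥0∞ := (volume Q.set)⁻¹ * ∫⁻ x in Q.set, U x

theorem lt_mean_iff {U : Rd d → ℝ≥0∞} {Q : Cube d} {t : ℝ≥0∞} :
    t < mean U Q ↔ t * volume Q.set < ∫⁻ x in Q.set, U x := by
  rw [mean, mul_comm, ← div_eq_mul_inv,
    ENNReal.lt_div_iff_mul_lt (Or.inl Q.volume_ne_zero) (Or.inl Q.volume_ne_top)]

theorem mean_le_iff {U : Rd d → ℝ≥0∞} {Q : Cube d} {t : ℝ≥0∞} :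
    mean U Q ≤ t ↔ ∫⁻ x in Q.set, U x ≤ t * volume Q.set := by
  rw [← not_lt, lt_mean_iff, not_lt]

theorem mean_mul_volume (U : Rd d → ℝ≥0∞) (Q : Cube d) :
    mean U Q * volume Q.set = ∫⁻ x in Q.set, U x := by
  rw [mean, mul_comm, ← mul_assoc, ENNReal.mul_inv_cancel Q.volume_ne_zero Q.volume_ne_top,
    one_mul]

/-- The points of `R` lying in a dyadic subcube of `R` with average exceeding `t`. -/
def levelSet (U : Rd d → ℝ≥0∞) (R : Cube d) (t : ℝ≥0∞) : Set (Rd d) :=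
  {x | x ∈ R.set ∧ ∃ n, t < mean U (R.cell n x)}

open Classical in
/-- The largest dyadic subcube of `R` containing `x` with average exceeding `t`. -/
def stopCube (U : Rd d → ℝ≥0∞) (R : Cube d) (t : ℝ≥0∞) (x : Rd d) : Cube d :=
  if h : ∃ n, t < mean U (R.cell n x) then R.cell (Nat.find h) x else R

section

variable {U : Rd d → ℝ≥0∞} {R : Cube d} {t : ℝ≥0∞}

open Classical in
theorem stopCube_eq {x : Rd d} (hx : x ∈ levelSet U R t) :
    stopCube U R t x = R.cell (Nat.find hx.2) x := dif_pos hx.2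

theorem mem_stopCube {x : Rd d} (hx : x ∈ levelSet U R t) : x ∈ (stopCube U R t x).set := by
  classical
  rw [stopCube_eq hx]
  exact Cube.mem_cell hx.1 _

theorem lt_mean_stopCube {x : Rd d} (hx : x ∈ levelSet U R t) :
    t < mean U (stopCube U R t x) := by
  classical
  rw [stopCube_eq hx]
  exact Nat.find_spec hx.2

theorem stopCube_subset {x : Rd d} (hx : x ∈ levelSet U R t) :
    (stopCube U R t x).set ⊆ levelSet U R t := by
  classical
  intro y hy
  have h := lt_mean_stopCube hx
  rw [stopCube_eq hx] at hy h
  exact ⟨R.cell_subset _ _ hy, _, by rwa [Cube.cell_eq_of_mem hy]⟩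

theorem stopCube_eq_of_mem {x y : Rd d} (hx : x ∈ levelSet U R t)
    (hy : y ∈ (stopCube U R t x).set) : stopCube U R t y = stopCube U R t x := by
  classical
  have hyl := stopCube_subset hx hy
  have hmean := lt_mean_stopCube hx
  rw [stopCube_eq hx] at hy hmean ⊢
  rw [stopCube_eq hyl]
  have key : ∀ n ≤ Nat.find hx.2, R.cell n y = R.cell n x := fun n hn =>
    Cube.cell_eq_of_mem (R.cell_antitone x hn hy)
  have hfind : Nat.find hyl.2 = Nat.find hx.2 := by
    rw [Nat.find_eq_iff]
    refine ⟨by rwa [key _ le_rfl], fun n hn => ?_⟩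
    rw [key n hn.le]
    exact Nat.find_min hx.2 hn
  rw [hfind, key _ le_rfl]

theorem stopCube_mono {t' : ℝ≥0∞} (htt' : t ≤ t') {x : Rd d} (hx : x ∈ levelSet U R t')
    (hx' : x ∈ levelSet U R t) :
    (stopCube U R t' x).set ⊆ (stopCube U R t x).set := by
  classical
  rw [stopCube_eq hx, stopCube_eq hx']
  exact R.cell_antitone x (Nat.find_min' _ (htt'.trans_lt (Nat.find_spec hx.2)))

theorem levelSet_anti {t' : ℝ≥0∞} (htt' : t ≤ t') : levelSet U R t' ⊆ levelSet U R t :=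
  fun _ hx => ⟨hx.1, hx.2.imp fun _ h => htt'.trans_lt h⟩

theorem setLIntegral_stopCube_le (hR : mean U R ≤ t) {x : Rd d} (hx : x ∈ levelSet U R t) :
    ∫⁻ y in (stopCube U R t x).set, U y ≤ 2 ^ d * t * volume (stopCube U R t x).set := by
  classical
  rw [stopCube_eq hx]
  have hpos : Nat.find hx.2 ≠ 0 := by
    intro h0
    have := Nat.find_spec hx.2
    rw [h0] at this
    exact absurd this (not_lt.2 hR)
  obtain ⟨n, hn⟩ := Nat.exists_eq_succ_of_ne_zero hpos
  have hle : mean U (R.cell n x) ≤ t := not_lt.1 (Nat.find_min hx.2 (by omega))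
  rw [hn]
  calc ∫⁻ y in (R.cell (n + 1) x).set, U y ≤ ∫⁻ y in (R.cell n x).set, U y :=
        lintegral_mono_set (Cube.child_subset _ _)
    _ ≤ t * volume (R.cell n x).set := mean_le_iff.1 hle
    _ = _ := by
        rw [Cube.volume_child (R.cell n x) x]
        simp only [Cube.cell]
        ring

/-- The maximal dyadic subcubes of `R` with average exceeding `t`. -/
def stopCubes (U : Rd d → ℝ≥0∞) (R : Cube d) (t : ℝ≥0∞) : Set (Cube d) :=
  stopCube U R t '' levelSet U R t

theorem levelSet_eq_biUnion : levelSet U R t = ⋃ Q ∈ stopCubes U R t, Q.set := by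
  ext x
  simp only [stopCubes, mem_iUnion, mem_image, exists_prop]
  constructor
  · intro hx
    exact ⟨_, ⟨x, hx, rfl⟩, mem_stopCube hx⟩
  · rintro ⟨_, ⟨y, hy, rfl⟩, hxy⟩
    exact stopCube_subset hy hxy

theorem stopCubes_disjoint : (stopCubes U R t).PairwiseDisjoint Cube.set := by
  rintro _ ⟨x, hx, rfl⟩ _ ⟨y, hy, rfl⟩ hne
  refine Set.disjoint_left.2 fun z hzx hzy => hne ?_
  rw [← stopCube_eq_of_mem hx hzx, stopCube_eq_of_mem hy hzy]

theorem Cube.interior_nonempty (Q : Cube d) : (interior Q.set).Nonempty := by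
  rw [Q.set_eq_pi, interior_pi_set finite_univ]
  refine ⟨Q.center, fun i _ => ?_⟩
  have := Q.side_pos
  simp only [Cube.center, interior_Ico, mem_Ioo]
  constructor <;> linarith

theorem stopCubes_countable : (stopCubes U R t).Countable :=
  stopCubes_disjoint.countable_of_nonempty_interior fun Q _ => Q.interior_nonempty

theorem measurableSet_levelSet : MeasurableSet (levelSet U R t) := by
  rw [levelSet_eq_biUnion]
  exact MeasurableSet.biUnion stopCubes_countable fun Q _ => Q.measurableSet

theorem setLIntegral_levelSet (V : Rd d → ℝ≥0∞) :
    ∫⁻ x in levelSet U R t, V x = ∑' Q : stopCubes U R t, ∫⁻ x in Q.1.set, V x := by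
  rw [levelSet_eq_biUnion, lintegral_biUnion stopCubes_countable (fun Q _ => Q.measurableSet)
    stopCubes_disjoint]

/-- Localised reverse weak-type bound. -/
theorem setLIntegral_levelSet_inter_le {t' : ℝ≥0∞} (hR : mean U R ≤ t) (htt' : t ≤ t')
    {Q : Cube d} (hQ : Q ∈ stopCubes U R t) :
    ∫⁻ x in levelSet U R t' ∩ Q.set, U x ≤
      2 ^ d * t' * volume (levelSet U R t' ∩ Q.set) := by
  have hcover : levelSet U R t' ∩ Q.set =
      ⋃ P ∈ {P ∈ stopCubes U R t' | P.set ⊆ Q.set}, P.set := by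
    ext x
    simp only [mem_inter_iff, mem_iUnion, mem_ofPred_eq, exists_prop]
    constructor
    · rintro ⟨hx, hxQ⟩
      obtain ⟨y, hy, rfl⟩ := hQ
      refine ⟨_, ⟨⟨x, hx, rfl⟩, ?_⟩, mem_stopCube hx⟩
      rw [← stopCube_eq_of_mem hy hxQ]
      exact stopCube_mono htt' hx (levelSet_anti htt' hx)
    · rintro ⟨P, ⟨⟨y, hy, rfl⟩, hPQ⟩, hxP⟩
      exact ⟨stopCube_subset hy hxP, hPQ hxP⟩
  have hsub : {P ∈ stopCubes U R t' | P.set ⊆ Q.set} ⊆ stopCubes U R t' := fun P hP => hP.1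
  have hc := stopCubes_countable.mono hsub
  have hdj := stopCubes_disjoint.subset hsub
  rw [hcover, lintegral_biUnion hc (fun Q _ => Q.measurableSet) hdj,
    measure_biUnion hc hdj (fun Q _ => Q.measurableSet), ← ENNReal.tsum_mul_left]
  refine ENNReal.tsum_le_tsum fun P => ?_
  obtain ⟨y, hy, hyP⟩ := P.2.1
  rw [← hyP]
  exact setLIntegral_stopCube_le (hR.trans htt') hy

end

/-- The maximal function of `U 1_Q`. -/
def localMax (U : Rd d → ℝ≥0∞) (Q : Cube d) (x : Rd d) : ℝ≥0∞ :=
  ⨆ (P : Cube d) (_ : x ∈ P.set), mean (Q.set.indicator U) P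

theorem setLIntegral_indicator_of_subset {U : Rd d → ℝ≥0∞} {s t : Set (Rd d)}
    (ht : MeasurableSet t) (h : s ⊆ t) : ∫⁻ x in s, t.indicator U x = ∫⁻ x in s, U x := by
  rw [setLIntegral_indicator ht, inter_eq_self_of_subset_right h]

theorem mean_indicator {U : Rd d → ℝ≥0∞} {P Q : Cube d} (h : P.set ⊆ Q.set) :
    mean (Q.set.indicator U) P = mean U P := by
  rw [mean, mean, setLIntegral_indicator_of_subset Q.measurableSet h]

theorem mean_le_localMax {U : Rd d → ℝ≥0∞} {P Q : Cube d} {x : Rd d} (hx : x ∈ P.set)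
    (h : P.set ⊆ Q.set) : mean U P ≤ localMax U Q x := by
  rw [← mean_indicator h]
  exact le_iSup₂ (f := fun (P : Cube d) (_ : x ∈ P.set) => mean (Q.set.indicator U) P) P hx

theorem sum_two_pow_indicator_le {α : Type*} (A : ℕ → Set α) (x : α) (t b : ℝ≥0∞)
    (h : ∀ i, x ∈ A i → 2 ^ i * t ≤ b) (J : ℕ) :
    ∑ i ∈ Finset.range J, (A i).indicator (fun _ => 2 ^ i * t) x ≤ 2 * b := by
  have hgeom : ∀ n : ℕ, ∑ i ∈ Finset.range n, (A i).indicator (fun _ => 2 ^ i * t) x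
      ≤ 2 ^ n * t := by
    intro n
    induction n with
    | zero => simp
    | succ n ih =>
      rw [Finset.sum_range_succ, pow_succ, mul_assoc, two_mul, mul_add]
      exact add_le_add ih (indicator_le_self' (fun _ _ => zero_le) x)
  induction J with
  | zero => simp
  | succ n ih =>
    rw [Finset.sum_range_succ]
    by_cases hx : x ∈ A n
    · rw [indicator_of_mem hx, two_mul]
      exact add_le_add ((hgeom n).trans (h n hx)) (h n hx)
    · rwa [indicator_of_notMem hx, add_zero]

section

variable {U : Rd d → ℝ≥0∞} {R : Cube d} {Λ : ℝ≥0∞}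

theorem natCast_mul_setLIntegral_levelSet_le
    (hΛ : ∀ Q : Cube d, ∫⁻ x in Q.set, localMax U Q x ≤ Λ * ∫⁻ x in Q.set, U x)
    {t : ℝ≥0∞} (hR : mean U R ≤ t) (J : ℕ) :
    J * ∫⁻ x in levelSet U R (2 ^ J * t), U x ≤
      2 ^ (d + 1) * Λ * ∫⁻ x in levelSet U R t, U x := by
  have ht : ∀ i : ℕ, t ≤ 2 ^ i * t := fun i => le_mul_of_one_le_left' (one_le_pow₀ (by norm_num))
  have hmeas : ∀ i : ℕ, MeasurableSet (levelSet U R (2 ^ i * t)) := fun i =>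
    measurableSet_levelSet
  calc J * ∫⁻ x in levelSet U R (2 ^ J * t), U x
      = ∑ i ∈ Finset.range J, ∫⁻ x in levelSet U R (2 ^ J * t), U x := by simp
    _ ≤ ∑ i ∈ Finset.range J, ∫⁻ x in levelSet U R (2 ^ i * t), U x := by
        refine Finset.sum_le_sum fun i hi => lintegral_mono_set (levelSet_anti ?_)
        gcongr
        · norm_num
        · exact (Finset.mem_range.1 hi).le
    _ = ∑ i ∈ Finset.range J, ∑' Q : stopCubes U R t,
          ∫⁻ x in levelSet U R (2 ^ i * t) ∩ Q.1.set, U x := by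
        refine Finset.sum_congr rfl fun i _ => ?_
        rw [← inter_eq_self_of_subset_left (levelSet_anti (U := U) (R := R) (ht i)),
          ← setLIntegral_indicator (hmeas i), setLIntegral_levelSet]
        refine tsum_congr fun Q => ?_
        rw [setLIntegral_indicator (hmeas i),
          inter_eq_self_of_subset_left (levelSet_anti (ht i))]
    _ = ∑' Q : stopCubes U R t, ∑ i ∈ Finset.range J,
          ∫⁻ x in levelSet U R (2 ^ i * t) ∩ Q.1.set, U x :=
        (Summable.tsum_finsetSum fun _ _ => ENNReal.summable).symm
    _ ≤ ∑' Q : stopCubes U R t, 2 ^ (d + 1) * Λ * ∫⁻ x in Q.1.set, U x := by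
        refine ENNReal.tsum_le_tsum fun Q => ?_
        calc ∑ i ∈ Finset.range J, ∫⁻ x in levelSet U R (2 ^ i * t) ∩ Q.1.set, U x
            ≤ ∑ i ∈ Finset.range J, 2 ^ d * ∫⁻ x in Q.1.set,
                (levelSet U R (2 ^ i * t)).indicator (fun _ => 2 ^ i * t) x := by
              refine Finset.sum_le_sum fun i _ => ?_
              rw [setLIntegral_indicator (hmeas i), setLIntegral_const, ← mul_assoc]
              exact setLIntegral_levelSet_inter_le hR (ht i) Q.2
          _ = 2 ^ d * ∫⁻ x in Q.1.set, ∑ i ∈ Finset.range J,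
                (levelSet U R (2 ^ i * t)).indicator (fun _ => 2 ^ i * t) x := by
              rw [lintegral_finsetSum _ fun i _ => measurable_const.indicator (hmeas i),
                Finset.mul_sum]
          _ ≤ 2 ^ d * ∫⁻ x in Q.1.set, 2 * localMax U Q.1 x := by
              gcongr 2 ^ d * ?_
              refine setLIntegral_mono' Q.1.measurableSet fun x hx => ?_
              refine sum_two_pow_indicator_le _ x t _ (fun i hi => ?_) J
              obtain ⟨y, hy, hyQ⟩ := Q.2
              have hsub : (stopCube U R (2 ^ i * t) x).set ⊆ Q.1.set := by
                rw [← hyQ] at hx ⊢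
                rw [← stopCube_eq_of_mem hy hx]
                exact stopCube_mono (ht i) hi (levelSet_anti (ht i) hi)
              exact (lt_mean_stopCube hi).le.trans (mean_le_localMax (mem_stopCube hi) hsub)
          _ = 2 ^ (d + 1) * ∫⁻ x in Q.1.set, localMax U Q.1 x := by
              rw [lintegral_const_mul' _ _ (by norm_num), pow_succ, mul_assoc]
          _ ≤ 2 ^ (d + 1) * (Λ * ∫⁻ x in Q.1.set, U x) := by
              gcongr
              exact hΛ Q.1
          _ = _ := by rw [mul_assoc]
    _ = _ := by rw [ENNReal.tsum_mul_left, setLIntegral_levelSet]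

theorem two_pow_mul_setLIntegral_levelSet_le
    (hΛ : ∀ Q : Cube d, ∫⁻ x in Q.set, localMax U Q x ≤ Λ * ∫⁻ x in Q.set, U x)
    {J : ℕ} (hJ0 : J ≠ 0) (hJ : 2 ^ (d + 2) * Λ ≤ J) (k : ℕ) :
    2 ^ k * ∫⁻ x in levelSet U R (2 ^ (J * k) * mean U R), U x ≤ ∫⁻ x in R.set, U x := by
  induction k with
  | zero =>
    rw [pow_zero, one_mul]
    exact lintegral_mono_set fun x hx => hx.1
  | succ k ih =>
    refine le_trans ?_ ih
    set t := 2 ^ (J * k) * mean U R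
    have ht : mean U R ≤ t := le_mul_of_one_le_left' (one_le_pow₀ (by norm_num))
    rw [show (2 : ℝ≥0∞) ^ (J * (k + 1)) * mean U R = 2 ^ J * t by
      rw [← mul_assoc, ← pow_add]; ring_nf, pow_succ, mul_assoc]
    gcongr 2 ^ k * ?_
    have h := natCast_mul_setLIntegral_levelSet_le hΛ ht J
    rw [← ENNReal.mul_le_mul_iff_right (a := (J : ℝ≥0∞)) (by simpa using hJ0) (by simp)]
    calc (J : ℝ≥0∞) * (2 * ∫⁻ x in levelSet U R (2 ^ J * t), U x)
        = 2 * (J * ∫⁻ x in levelSet U R (2 ^ J * t), U x) := by ring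
      _ ≤ 2 * (2 ^ (d + 1) * Λ * ∫⁻ x in levelSet U R t, U x) := by gcongr
      _ = 2 ^ (d + 2) * Λ * ∫⁻ x in levelSet U R t, U x := by ring
      _ ≤ _ := by gcongr

end

section

variable {U : Rd d → ℝ≥0∞} {R : Cube d}

/-- Lebesgue differentiation along the dyadic subcubes of a cube. -/
theorem ae_le_of_notMem_levelSet (hU : AEMeasurable U) (hR : ∫⁻ x in R.set, U x ≠ ∞)
    (t : ℝ≥0∞) : ∀ᵐ x ∂volume, x ∈ R.set → x ∉ levelSet U R t → U x ≤ t := by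
  have hint : ∫⁻ x, R.set.indicator U x ≠ ∞ := by rwa [lintegral_indicator R.measurableSet]
  filter_upwards [(IsUnifLocDoublingMeasure.vitaliFamily (volume : Measure (Rd d))
    1).ae_tendsto_lintegral_div (hU.indicator R.measurableSet) hint] with x hx hxR hxl
  have hδ : Filter.Tendsto (fun n : ℕ => R.side / 2 ^ n / 2) Filter.atTop
      (nhdsWithin 0 (Ioi 0)) := by
    refine tendsto_nhdsWithin_iff.2 ⟨?_, Filter.Eventually.of_forall fun n => ?_⟩
    · have := (tendsto_pow_atTop_nhds_zero_of_lt_one (r := (1 / 2 : ℝ)) (by norm_num)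
        (by norm_num)).const_mul (R.side / 2)
      rw [mul_zero] at this
      refine this.congr fun n => ?_
      rw [one_div, inv_pow]
      ring
    · have := R.side_pos
      simp only [mem_Ioi]
      positivity
  have hball : ∀ n, x ∈ Metric.closedBall (R.cell n x).center (R.side / 2 ^ n / 2) := fun n => by
    rw [← R.cell_side n x]
    exact Cube.subset_closedBall _ (Cube.mem_cell hxR n)
  have hlim := hx.comp (IsUnifLocDoublingMeasure.tendsto_closedBall_filterAt volume
    (K := 1) (fun n => (R.cell n x).center) _ hδ
    (Filter.Eventually.of_forall fun n => by rw [one_mul]; exact hball n))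
  rw [indicator_of_mem hxR] at hlim
  refine le_of_tendsto hlim (Filter.Eventually.of_forall fun n => ?_)
  have hle : mean U (R.cell n x) ≤ t := not_lt.1 fun h => hxl ⟨hxR, n, h⟩
  simp only [Function.comp]
  rw [← R.cell_side n x, ← setLIntegral_congr (R.cell n x).ae_eq_closedBall,
    ← measure_congr (R.cell n x).ae_eq_closedBall, ENNReal.div_eq_inv_mul]
  change mean (R.set.indicator U) (R.cell n x) ≤ t
  rwa [mean_indicator (R.cell_subset n x)]

theorem setLIntegral_inter_le (hU : AEMeasurable U) (hR : ∫⁻ x in R.set, U x ≠ ∞)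
    {E : Set (Rd d)} (hE : MeasurableSet E) (t : ℝ≥0∞) :
    ∫⁻ x in E ∩ R.set, U x ≤ (∫⁻ x in levelSet U R t, U x) + t * volume (E ∩ R.set) := by
  have hsub : E ∩ R.set ⊆ levelSet U R t ∪ (E ∩ R.set) \ levelSet U R t := by
    rw [union_sdiff_self]
    exact subset_union_right
  refine (lintegral_mono_set hsub).trans ((lintegral_union_le _ _ _).trans ?_)
  refine add_le_add_right ?_ _
  calc ∫⁻ x in (E ∩ R.set) \ levelSet U R t, U x
      ≤ ∫⁻ x in (E ∩ R.set) \ levelSet U R t, t := by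
        refine setLIntegral_mono_ae' ((hE.inter R.measurableSet).diff measurableSet_levelSet) ?_
        filter_upwards [ae_le_of_notMem_levelSet hU hR t] with x hx hxE
        exact hx hxE.1.2 hxE.2
    _ ≤ _ := by
        rw [setLIntegral_const]
        gcongr
        exact sdiff_subset

/-- Quantitative `A_∞` property: a set carrying a proportion of the `U`-mass of a cube carries a
proportion of its Lebesgue measure. -/
theorem volume_le_of_setLIntegral_lt (hU : AEMeasurable U) (hR : ∫⁻ x in R.set, U x ≠ ∞)
    {Λ : ℝ≥0∞} (hΛ : ∀ Q : Cube d, ∫⁻ x in Q.set, localMax U Q x ≤ Λ * ∫⁻ x in Q.set, U x)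
    {J : ℕ} (hJ0 : J ≠ 0) (hJ : 2 ^ (d + 2) * Λ ≤ J)
    {E : Set (Rd d)} (hE : MeasurableSet E) (k : ℕ)
    (hk : ∫⁻ x in R.set, U x < 2 ^ (k + 1) * ∫⁻ x in E ∩ R.set, U x) :
    volume R.set ≤ 2 ^ ((J + 1) * (k + 2)) * volume (E ∩ R.set) := by
  have hdecay := two_pow_mul_setLIntegral_levelSet_le (R := R) hΛ hJ0 hJ (k + 2)
  have hsplit := setLIntegral_inter_le hU hR hE (2 ^ (J * (k + 2)) * mean U R)
  set I := ∫⁻ x in R.set, U x with hI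
  have hI0 : I ≠ 0 := by
    intro h0
    have hle : ∫⁻ x in E ∩ R.set, U x ≤ I := lintegral_mono_set inter_subset_right
    rw [h0, nonpos_iff_eq_zero] at hle
    rw [hle, mul_zero] at hk
    exact absurd hk (by simp)
  have h2 : I + I ≤ I + 2 ^ ((J + 1) * (k + 2)) * mean U R * volume (E ∩ R.set) := by
    calc I + I = 2 * I := (two_mul I).symm
      _ ≤ 2 * (2 ^ (k + 1) * ∫⁻ x in E ∩ R.set, U x) := by gcongr
      _ = 2 ^ (k + 2) * ∫⁻ x in E ∩ R.set, U x := by ring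
      _ ≤ 2 ^ (k + 2) * ((∫⁻ x in levelSet U R (2 ^ (J * (k + 2)) * mean U R), U x) +
            2 ^ (J * (k + 2)) * mean U R * volume (E ∩ R.set)) := by gcongr
      _ ≤ I + 2 ^ (k + 2) * (2 ^ (J * (k + 2)) * mean U R * volume (E ∩ R.set)) := by
          rw [mul_add]
          gcongr
      _ = _ := by ring
  have h3 := (ENNReal.add_le_add_iff_left hR).1 h2
  rw [hI, ← mean_mul_volume] at h3
  have hm0 : mean U R ≠ 0 := by
    intro h0
    rw [hI, ← mean_mul_volume, h0, zero_mul] at hI0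
    exact hI0 rfl
  have hmt : mean U R ≠ ∞ := ENNReal.mul_ne_top (ENNReal.inv_ne_top.2 R.volume_ne_zero) hR
  rw [← ENNReal.mul_le_mul_iff_right hm0 hmt]
  calc _ ≤ _ := h3
    _ = _ := by ring

end

section

variable {S : Set (Cube d)} {H : Rd d → ℝ≥0∞} {B : ℝ≥0∞}

theorem IsSparse.sum_setLIntegral_le_of_mean_mem (hS : IsSparse (1 / 2) S)
    (hH : ∫⁻ x, H x ≤ B) (N : ℕ) (c : ℝ≥0∞) (F : Finset (Cube d)) (hF : ∀ Q ∈ F, Q ∈ S)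
    (hup : ∀ Q ∈ F, ∫⁻ x in Q.set, H x ≤ c * volume Q.set)
    (hlow : ∀ Q ∈ F, c * volume Q.set ≤ 2 ^ N * ∫⁻ x in Q.set, H x) :
    ∑ Q ∈ F, ∫⁻ x in Q.set, H x ≤ 4 * 5 ^ d * B * (N + 1) := by
  classical
  have hone : ∀ (c : ℝ≥0∞) (F : Finset (Cube d)), (∀ Q ∈ F, Q ∈ S) →
      (∀ Q ∈ F, ∫⁻ x in Q.set, H x ≤ c * volume Q.set) →
      (∀ Q ∈ F, c * volume Q.set ≤ 2 * ∫⁻ x in Q.set, H x) →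
      ∑ Q ∈ F, ∫⁻ x in Q.set, H x ≤ 4 * 5 ^ d * B := by
    intro c F hF hup hlow
    calc ∑ Q ∈ F, ∫⁻ x in Q.set, H x ≤ ∑ Q ∈ F, c * volume Q.set := Finset.sum_le_sum hup
      _ = c * ∑ Q ∈ F, volume Q.set := by rw [Finset.mul_sum]
      _ ≤ 2 * 5 ^ d * ∫⁻ x, 2 * H x := by
          refine hS.mul_sum_volume_le F hF _ c fun Q hQ => ?_
          rw [lintegral_const_mul' _ _ (by norm_num)]
          exact hlow Q hQ
      _ ≤ 2 * 5 ^ d * (2 * B) := by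
          rw [lintegral_const_mul' _ _ (by norm_num)]
          gcongr
      _ = _ := by ring
  induction N generalizing c F with
  | zero =>
    rw [Nat.cast_zero, zero_add, mul_one]
    refine hone c F hF hup fun Q hQ => (hlow Q hQ).trans ?_
    gcongr
    norm_num
  | succ N ih =>
    rw [← Finset.sum_filter_add_sum_filter_not F
      (fun Q => c * volume Q.set ≤ 2 * ∫⁻ x in Q.set, H x), add_comm]
    push_cast
    rw [mul_add _ ((N : ℝ≥0∞) + 1), mul_one]
    have h2 : c = 2 * (c / 2) := (ENNReal.mul_div_cancel (by norm_num) (by norm_num)).symm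
    refine add_le_add (ih (c / 2) _ (fun Q hQ => hF Q (Finset.mem_filter.1 hQ).1)
      (fun Q hQ => ?_) (fun Q hQ => ?_)) (hone c _ (fun Q hQ => hF Q (Finset.mem_filter.1 hQ).1)
      (fun Q hQ => hup Q (Finset.mem_filter.1 hQ).1) fun Q hQ => (Finset.mem_filter.1 hQ).2)
    · have h := (not_le.1 (Finset.mem_filter.1 hQ).2).le
      rw [h2, mul_assoc, ENNReal.mul_le_mul_iff_right (by norm_num) (by norm_num)] at h
      exact h
    · have h := hlow Q (Finset.mem_filter.1 hQ).1
      rw [h2, pow_succ', mul_assoc, mul_assoc,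
        ENNReal.mul_le_mul_iff_right (by norm_num) (by norm_num)] at h
      exact h

theorem IsSparse.sum_setLIntegral_le (hS : IsSparse (1 / 2) S) (hH : ∫⁻ x, H x ≤ B) (N : ℕ)
    (c K : ℝ≥0∞) {E : Set (Rd d)} (hE : MeasurableSet E) (hcE : c * volume E ≤ K)
    (F : Finset (Cube d)) (hF : ∀ Q ∈ F, Q ∈ S)
    (hup : ∀ Q ∈ F, ∫⁻ x in Q.set, H x ≤ c * volume Q.set)
    (hvol : ∀ Q ∈ F, volume Q.set ≤ 2 ^ N * volume (E ∩ Q.set)) :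
    ∑ Q ∈ F, ∫⁻ x in Q.set, H x ≤ 4 * 5 ^ d * B * (N + 1) + 2 * 5 ^ d * K := by
  classical
  rw [← Finset.sum_filter_add_sum_filter_not F
      (fun Q => c * volume Q.set ≤ 2 ^ N * ∫⁻ x in Q.set, H x)]
  refine add_le_add (hS.sum_setLIntegral_le_of_mean_mem hH N c _
    (fun Q hQ => hF Q (Finset.mem_filter.1 hQ).1) (fun Q hQ => hup Q (Finset.mem_filter.1 hQ).1)
    fun Q hQ => (Finset.mem_filter.1 hQ).2) ?_
  set F' := F.filter fun Q => ¬ c * volume Q.set ≤ 2 ^ N * ∫⁻ x in Q.set, H x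
  have hF' : ∀ Q ∈ F', Q ∈ F := fun Q hQ => (Finset.mem_filter.1 hQ).1
  rw [← ENNReal.mul_le_mul_iff_right (a := (2 : ℝ≥0∞) ^ N) (by simp) (by simp)]
  calc 2 ^ N * ∑ Q ∈ F', ∫⁻ x in Q.set, H x
      = ∑ Q ∈ F', 2 ^ N * ∫⁻ x in Q.set, H x := by rw [Finset.mul_sum]
    _ ≤ ∑ Q ∈ F', c * volume Q.set :=
        Finset.sum_le_sum fun Q hQ => (not_le.1 (Finset.mem_filter.1 hQ).2).le
    _ = c * (1 * ∑ Q ∈ F', volume Q.set) := by rw [one_mul, Finset.mul_sum]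
    _ ≤ c * (2 * 5 ^ d * ∫⁻ x, 2 ^ N * E.indicator 1 x) := by
        gcongr c * ?_
        refine hS.mul_sum_volume_le F' (fun Q hQ => hF Q (hF' Q hQ)) _ 1 fun Q hQ => ?_
        rw [lintegral_const_mul' _ _ (by simp), setLIntegral_indicator hE, one_mul]
        simpa using hvol Q (hF' Q hQ)
    _ = 2 ^ N * (2 * 5 ^ d * (c * volume E)) := by
        rw [lintegral_const_mul' _ _ (by simp), lintegral_indicator_one hE]
        ring
    _ ≤ _ := by gcongr

end

/-- A convergent arithmetico-geometric series. -/
def levelSeries (α : ℝ) : ℝ≥0∞ := ∑' k : ℕ, ((k : ℝ≥0∞) + 2) * ((2⁻¹ : ℝ≥0∞) ^ k) ^ α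

theorem levelSeries_ne_top {α : ℝ} (hα : 0 < α) : levelSeries α ≠ ∞ := by
  set r : ℝ := (2⁻¹ : ℝ) ^ α with hr
  have hr0 : 0 ≤ r := by positivity
  have hr1 : ‖r‖ < 1 := by
    rw [Real.norm_of_nonneg hr0]
    exact Real.rpow_lt_one (by norm_num) (by norm_num) hα
  have hsum : Summable fun k : ℕ => ((k : ℝ) + 2) * r ^ k := by
    simp_rw [add_mul]
    refine Summable.add ?_ ((summable_geometric_of_norm_lt_one hr1).mul_left 2)
    simpa using summable_pow_mul_geometric_of_norm_lt_one 1 hr1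
  have heq : levelSeries α = ∑' k : ℕ, ENNReal.ofReal (((k : ℝ) + 2) * r ^ k) := by
    refine tsum_congr fun k => ?_
    rw [ENNReal.ofReal_mul (by positivity), ENNReal.ofReal_add (by positivity) (by norm_num),
      ENNReal.ofReal_natCast, ENNReal.ofReal_ofNat, ENNReal.ofReal_pow hr0, hr,
      ← ENNReal.ofReal_rpow_of_pos (by norm_num), ENNReal.ofReal_inv_of_pos (by norm_num),
      ENNReal.ofReal_ofNat, ← ENNReal.rpow_natCast, ← ENNReal.rpow_natCast, ← ENNReal.rpow_mul,
      ← ENNReal.rpow_mul, mul_comm (k : ℝ) α]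
  rw [heq]
  exact hsum.tsum_ofReal_ne_top

theorem rpow_mul_le_tsum_levels {α : ℝ} (hα : 0 < α) {a b I : ℝ≥0∞} (hb0 : b ≠ 0) (hb : b ≠ ∞)
    (hab : a ≤ b) :
    (a / b) ^ α * I ≤ ∑' k : ℕ, ((2⁻¹ : ℝ≥0∞) ^ k) ^ α *
      (if b < 2 ^ (k + 1) * a then I else 0) := by
  rcases eq_or_ne a 0 with rfl | ha0
  · simp [ENNReal.zero_rpow_of_pos hα]
  have ha : a ≠ ∞ := ne_top_of_le_ne_top hb hab
  have hρ : a / b ≠ ∞ := ENNReal.div_ne_top ha hb0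
  have hpos : 0 < (a / b).toReal := ENNReal.toReal_pos (ENNReal.div_ne_zero.2 ⟨ha0, hb⟩) hρ
  have hle : (a / b).toReal ≤ 1 := by
    rw [← ENNReal.toReal_one]
    exact ENNReal.toReal_mono (by simp) (ENNReal.div_le_of_le_mul (by rwa [one_mul]))
  obtain ⟨k, hk1, hk2⟩ := exists_nat_pow_near_of_lt_one hpos hle
    (show (0 : ℝ) < 2⁻¹ by norm_num) (by norm_num)
  have key : ∀ n : ℕ, ENNReal.ofReal ((2⁻¹ : ℝ) ^ n) = (2⁻¹ : ℝ≥0∞) ^ n := fun n => by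
    rw [ENNReal.ofReal_pow (by norm_num), ENNReal.ofReal_inv_of_pos (by norm_num),
      ENNReal.ofReal_ofNat]
  have h1 : (2⁻¹ : ℝ≥0∞) ^ (k + 1) < a / b := by
    rw [← key, ← ENNReal.ofReal_toReal hρ]
    exact (ENNReal.ofReal_lt_ofReal_iff hpos).2 hk1
  have h2 : a / b ≤ (2⁻¹ : ℝ≥0∞) ^ k := by
    rw [← key, ← ENNReal.ofReal_toReal hρ]
    exact ENNReal.ofReal_le_ofReal hk2
  have h3 : b < 2 ^ (k + 1) * a := by
    rw [ENNReal.lt_div_iff_mul_lt (Or.inl hb0) (Or.inl hb), ← ENNReal.inv_pow, mul_comm,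
      ← div_eq_mul_inv] at h1
    rw [mul_comm]
    exact (ENNReal.div_lt_iff (Or.inl (by simp)) (Or.inl (by simp))).1 h1
  refine le_trans ?_ (ENNReal.le_tsum k)
  rw [if_pos h3]
  gcongr

/-- Summation over a sparse family, weighted by a power of the relative `U`-mass of a set. -/
theorem IsSparse.sum_rpow_mul_le {S : Set (Cube d)} (hS : IsSparse (1 / 2) S)
    {H : Rd d → ℝ≥0∞} {B : ℝ≥0∞} (hH : ∫⁻ x, H x ≤ B) {c : ℝ≥0∞} {E : Set (Rd d)}
    (hE : MeasurableSet E) (hcE : c * volume E ≤ 2 * 5 ^ d * B)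
    (hup : ∀ Q : Cube d, volume (E ∩ Q.set) ≠ 0 → ∫⁻ x in Q.set, H x ≤ c * volume Q.set)
    {U : Rd d → ℝ≥0∞} (hU : AEMeasurable U) (hU0 : ∀ Q : Cube d, ∫⁻ x in Q.set, U x ≠ 0)
    (hUt : ∀ Q : Cube d, ∫⁻ x in Q.set, U x ≠ ∞) {Λ : ℝ≥0∞}
    (hΛ : ∀ Q : Cube d, ∫⁻ x in Q.set, localMax U Q x ≤ Λ * ∫⁻ x in Q.set, U x)
    {J : ℕ} (hJ0 : J ≠ 0) (hJ : 2 ^ (d + 2) * Λ ≤ J) {α : ℝ} (hα : 0 < α)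
    (F : Finset (Cube d)) (hF : ∀ Q ∈ F, Q ∈ S) :
    ∑ Q ∈ F, ((∫⁻ x in E ∩ Q.set, U x) / ∫⁻ x in Q.set, U x) ^ α * ∫⁻ x in Q.set, H x ≤
      4 * 25 ^ d * B * (J + 2) * levelSeries α := by
  classical
  set I : Cube d → ℝ≥0∞ := fun Q => ∫⁻ x in Q.set, H x
  set Fk : ℕ → Finset (Cube d) := fun k =>
    F.filter fun Q => ∫⁻ x in Q.set, U x < 2 ^ (k + 1) * ∫⁻ x in E ∩ Q.set, U x with hFk
  have hlevel : ∀ k, ∑ Q ∈ Fk k, I Q ≤ 4 * 25 ^ d * B * (J + 2) * (k + 2) := by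
    intro k
    have hvol : ∀ Q ∈ Fk k, volume Q.set ≤ 2 ^ ((J + 1) * (k + 2)) * volume (E ∩ Q.set) :=
      fun Q hQ => volume_le_of_setLIntegral_lt hU (hUt Q) hΛ hJ0 hJ hE k (Finset.mem_filter.1 hQ).2
    have h := hS.sum_setLIntegral_le hH ((J + 1) * (k + 2)) c (2 * 5 ^ d * B) hE hcE (Fk k)
      (fun Q hQ => hF Q (Finset.mem_filter.1 hQ).1) (fun Q hQ => hup Q fun h0 => ?_) hvol
    · refine h.trans ?_
      have h25 : (25 : ℝ≥0∞) ^ d = 5 ^ d * 5 ^ d := by rw [← mul_pow]; norm_num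
      have h5 : (5 : ℝ≥0∞) ^ d ≤ 25 ^ d := by gcongr; norm_num
      calc 4 * 5 ^ d * B * (((J + 1) * (k + 2) : ℕ) + 1) + 2 * 5 ^ d * (2 * 5 ^ d * B)
          ≤ 4 * 25 ^ d * B * (((J + 1) * (k + 2) : ℕ) + 1) + 4 * 25 ^ d * B := by
            gcongr ?_ + ?_
            · gcongr
            · rw [h25]
              exact le_of_eq (by ring)
        _ = 4 * 25 ^ d * B * (((J + 1) * (k + 2) + 2 : ℕ) : ℝ≥0∞) := by
            push_cast
            ring
        _ ≤ 4 * 25 ^ d * B * (((J + 2) * (k + 2) : ℕ) : ℝ≥0∞) := by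
            gcongr
            nlinarith
        _ = _ := by
            push_cast
            ring
    · have := hvol Q hQ
      rw [h0, mul_zero, nonpos_iff_eq_zero] at this
      exact Q.volume_ne_zero this
  calc ∑ Q ∈ F, ((∫⁻ x in E ∩ Q.set, U x) / ∫⁻ x in Q.set, U x) ^ α * I Q
      ≤ ∑ Q ∈ F, ∑' k : ℕ, ((2⁻¹ : ℝ≥0∞) ^ k) ^ α *
          (if ∫⁻ x in Q.set, U x < 2 ^ (k + 1) * ∫⁻ x in E ∩ Q.set, U x then I Q else 0) :=
        Finset.sum_le_sum fun Q _ => rpow_mul_le_tsum_levels hα (hU0 Q) (hUt Q)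
          (lintegral_mono_set inter_subset_right)
    _ = ∑' k : ℕ, ((2⁻¹ : ℝ≥0∞) ^ k) ^ α * ∑ Q ∈ Fk k, I Q := by
        rw [← Summable.tsum_finsetSum fun _ _ => ENNReal.summable]
        refine tsum_congr fun k => ?_
        rw [← Finset.mul_sum, hFk, Finset.sum_filter]
    _ ≤ ∑' k : ℕ, ((2⁻¹ : ℝ≥0∞) ^ k) ^ α * (4 * 25 ^ d * B * (J + 2) * (k + 2)) := by
        gcongr with k
        exact hlevel k
    _ = _ := by
        rw [levelSeries, ← ENNReal.tsum_mul_left]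
        refine tsum_congr fun k => ?_
        ring

theorem ofFn_eq_enorm (f : Rd d → ℝ) : ofFn f = fun x => ‖f x‖ₑ := by
  ext x
  rw [ofFn, Real.enorm_eq_ofReal_abs]

theorem avg_one (f : Rd d → ℝ) (Q : Cube d) : avg f 1 Q = mean (ofFn f) Q := by
  simp [avg, eAvg, mean]

/-- Normalised Lebesgue measure on a cube. -/
def Cube.prob (Q : Cube d) : Measure (Rd d) := (volume Q.set)⁻¹ • volume.restrict Q.set

theorem lintegral_prob (U : Rd d → ℝ≥0∞) (Q : Cube d) : ∫⁻ x, U x ∂Q.prob = mean U Q := by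
  rw [Cube.prob, lintegral_smul_measure, mean, smul_eq_mul]

theorem Cube.prob_ac (Q : Cube d) : Q.prob ≪ volume :=
  Measure.smul_absolutelyContinuous.trans Measure.restrict_le_self.absolutelyContinuous

theorem Cube.inv_volume_ne_zero (Q : Cube d) : (volume Q.set)⁻¹ ≠ 0 :=
  ENNReal.inv_ne_zero.2 Q.volume_ne_top

theorem Cube.prob_ne_zero (Q : Cube d) : Q.prob ≠ 0 := by
  intro h
  have h1 : Q.prob Q.set = 1 := by
    rw [Cube.prob, Measure.smul_apply, smul_eq_mul, Measure.restrict_apply_self,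
      ENNReal.inv_mul_cancel Q.volume_ne_zero Q.volume_ne_top]
  rw [h] at h1
  simp at h1

theorem avgE_eq_eLpNorm (f : Rd d → ℝ) {q : ℝ≥0∞} (hq : q ≠ 0) (Q : Cube d) :
    avgE f q Q = eLpNorm f q Q.prob := by
  rw [avgE]
  split_ifs with h
  · rw [h, eLpNorm_exponent_top, Cube.prob,
      eLpNormEssSup_ennreal_smul_measure Q.inv_volume_ne_zero, eLpNormEssSup, ofFn_eq_enorm]
  · rw [eLpNorm_eq_lintegral_rpow_enorm_toReal hq h, lintegral_prob, avg, eAvg, ofFn_eq_enorm, mean]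

theorem conj_holder {q : ℝ≥0∞} (hq : 1 ≤ q) : HolderTriple q (conj q) 1 := by
  refine ⟨?_⟩
  rw [conj, inv_inv, inv_one]
  exact add_tsub_cancel_of_le (ENNReal.inv_le_one.2 hq)

theorem conj_ne_zero {q : ℝ≥0∞} : conj q ≠ 0 :=
  ENNReal.inv_ne_zero.2 (ne_top_of_le_ne_top one_ne_top tsub_le_self)

theorem mean_mul_le {f v : Rd d → ℝ} (hf : AEMeasurable f) (hv : AEMeasurable v) {q : ℝ≥0∞}
    (hq : 1 ≤ q) (Q : Cube d) :
    mean (ofFn fun x => f x * v x) Q ≤ eLpNorm f q Q.prob * avgE v (conj q) Q := by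
  have := conj_holder hq
  rw [avgE_eq_eLpNorm _ conj_ne_zero, ← lintegral_prob, ofFn_eq_enorm, ← eLpNorm_one_eq_lintegral_enorm]
  exact eLpNorm_smul_le_mul_eLpNorm (φ := f) (f := v)
    (hv.mono_ac Q.prob_ac).aestronglyMeasurable (hf.mono_ac Q.prob_ac).aestronglyMeasurable

/-- The normalised density `(|f| / ‖f‖_q)^q`. -/
def density (f : Rd d → ℝ) (q : ℝ≥0∞) (x : Rd d) : ℝ≥0∞ :=
  if q = ∞ then 0 else (ofFn f x / eLpNorm f q volume) ^ q.toReal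

theorem lintegral_ofFn_rpow {f : Rd d → ℝ} {q : ℝ≥0∞} (hq : 1 ≤ q) (hqt : q ≠ ∞)
    (μ : Measure (Rd d)) : ∫⁻ x, ofFn f x ^ q.toReal ∂μ = eLpNorm f q μ ^ q.toReal := by
  have hq0 : 0 < q.toReal := ENNReal.toReal_pos (by positivity) hqt
  rw [eLpNorm_eq_lintegral_rpow_enorm_toReal (by positivity) hqt, ← ENNReal.rpow_mul,
    one_div_mul_cancel hq0.ne', ENNReal.rpow_one, ofFn_eq_enorm]

theorem lintegral_density {f : Rd d → ℝ} {q : ℝ≥0∞} (hq : 1 ≤ q) (hqt : q ≠ ∞)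
    (h0 : eLpNorm f q volume ≠ 0) (μ : Measure (Rd d)) :
    ∫⁻ x, density f q x ∂μ = (eLpNorm f q μ / eLpNorm f q volume) ^ q.toReal := by
  have hq0 : 0 ≤ q.toReal := ENNReal.toReal_nonneg
  have hinv : (eLpNorm f q volume)⁻¹ ≠ ∞ := ENNReal.inv_ne_top.2 h0
  simp only [density, if_neg hqt, div_eq_mul_inv, ENNReal.mul_rpow_of_nonneg _ _ hq0]
  rw [lintegral_mul_const' _ _ (ENNReal.rpow_ne_top_of_nonneg hq0 hinv),
    lintegral_ofFn_rpow hq hqt]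

theorem lintegral_density_le {f : Rd d → ℝ} {q : ℝ≥0∞} (hq : 1 ≤ q)
    (h0 : eLpNorm f q volume ≠ 0) : ∫⁻ x, density f q x ≤ 1 := by
  rcases eq_or_ne q ∞ with rfl | hqt
  · simp [density]
  · rw [lintegral_density hq hqt h0]
    exact ENNReal.rpow_le_one (ENNReal.div_self_le_one) ENNReal.toReal_nonneg

theorem eLpNorm_prob_le {f : Rd d → ℝ} {q : ℝ≥0∞} (hq : 1 ≤ q)
    (h0 : eLpNorm f q volume ≠ 0) (ht : eLpNorm f q volume ≠ ∞) (Q : Cube d) :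
    eLpNorm f q Q.prob ≤ eLpNorm f q volume * mean (density f q) Q ^ (q⁻¹).toReal := by
  rcases eq_or_ne q ∞ with rfl | hqt
  · simpa using eLpNormEssSup_mono_measure f Q.prob_ac
  · have hq0 : 0 < q.toReal := ENNReal.toReal_pos (by positivity) hqt
    rw [← lintegral_prob, lintegral_density hq hqt h0, ENNReal.toReal_inv, ← ENNReal.rpow_mul,
      mul_inv_cancel₀ hq0.ne', ENNReal.rpow_one, ENNReal.mul_div_cancel h0 ht]

theorem prod_rpow_le_sum_rpow {ι : Type*} (s : Finset ι) (a : ι → ℝ≥0∞) (θ : ι → ℝ)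
    (hθ : ∀ i ∈ s, 0 ≤ θ i) :
    ∏ i ∈ s, a i ^ θ i ≤ (∑ i ∈ s, a i) ^ (∑ i ∈ s, θ i) := by
  have hprod : ∀ (b : ℝ≥0∞) (t : Finset ι), (∀ i ∈ t, 0 ≤ θ i) →
      ∏ i ∈ t, b ^ θ i = b ^ (∑ i ∈ t, θ i) := by
    classical
    intro b t
    induction t using Finset.induction_on with
    | empty => simp
    | insert i t hi ih =>
      intro h
      rw [Finset.prod_insert hi, Finset.sum_insert hi,
        ih fun j hj => h j (Finset.mem_insert_of_mem hj), ENNReal.rpow_add_of_nonneg _ _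
          (h i (Finset.mem_insert_self i t))
          (Finset.sum_nonneg fun j hj => h j (Finset.mem_insert_of_mem hj))]
  rw [← hprod _ s hθ]
  refine Finset.prod_le_prod' fun i hi => ENNReal.rpow_le_rpow ?_ (hθ i hi)
  exact Finset.single_le_sum (fun _ _ => zero_le) hi

/-- Hölder's inequality on a set of finite measure. -/
theorem setLIntegral_ofFn_le {w : Rd d → ℝ} (hw : AEMeasurable w) {P : ℝ} (hP : 1 ≤ P)
    (E : Set (Rd d)) :
    ∫⁻ x in E, ofFn w x ≤ (∫⁻ x in E, ofFn w x ^ P) ^ (1 / P) * volume E ^ (1 - 1 / P) := by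
  have h := eLpNorm_le_eLpNorm_mul_rpow_measure_univ (μ := volume.restrict E) (p := 1)
    (q := ENNReal.ofReal P) (by simpa using hP) hw.restrict.aestronglyMeasurable
  have hP0 : 0 < P := by linarith
  rw [eLpNorm_one_eq_lintegral_enorm, eLpNorm_eq_lintegral_rpow_enorm_toReal (by simpa using hP0)
    (by simp), ENNReal.toReal_ofReal hP0.le, Measure.restrict_apply_univ, ENNReal.toReal_one,
    div_one] at h
  rwa [ofFn_eq_enorm]

theorem setLIntegral_ofFn_le_avg {w : Rd d → ℝ} (hw : AEMeasurable w) {P : ℝ} (hP : 1 ≤ P)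
    {E : Set (Rd d)} (hE : MeasurableSet E) {Q : Cube d} (h0 : ∫⁻ x in Q.set, ofFn w x ^ P ≠ 0)
    (ht : ∫⁻ x in Q.set, ofFn w x ^ P ≠ ∞) :
    ∫⁻ x in E ∩ Q.set, ofFn w x ≤ avg w P Q *
      ((∫⁻ x in E ∩ Q.set, ofFn w x ^ P) / ∫⁻ x in Q.set, ofFn w x ^ P) ^ (1 / P) *
      (mean (E.indicator 1) Q ^ (1 - 1 / P) * volume Q.set) := by
  have hP0 : 0 ≤ 1 / P := by positivity
  have hP1 : 0 ≤ 1 - 1 / P := by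
    rw [sub_nonneg]
    exact (div_le_one (by linarith)).2 hP
  have hvol : volume Q.set = volume Q.set ^ (1 / P) * volume Q.set ^ (1 - 1 / P) := by
    rw [← ENNReal.rpow_add_of_nonneg _ _ hP0 hP1]
    simp
  have hmean : mean (E.indicator 1) Q * volume Q.set = volume (E ∩ Q.set) := by
    rw [mean_mul_volume, setLIntegral_indicator hE]
    simp
  refine (setLIntegral_ofFn_le hw hP _).trans (le_of_eq ?_)
  rw [← hmean, ENNReal.mul_rpow_of_nonneg _ _ hP1, avg, eAvg]
  set u := ∫⁻ x in Q.set, ofFn w x ^ P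
  set u' := ∫⁻ x in E ∩ Q.set, ofFn w x ^ P
  have hu : u' = (volume Q.set)⁻¹ * u * (u' / u) * volume Q.set := by
    calc u' = u * (u' / u) := (ENNReal.mul_div_cancel h0 ht).symm
      _ = ((volume Q.set)⁻¹ * volume Q.set) * (u * (u' / u)) := by
          rw [ENNReal.inv_mul_cancel Q.volume_ne_zero Q.volume_ne_top, one_mul]
      _ = _ := by ring
  calc u' ^ (1 / P) * (mean (E.indicator 1) Q ^ (1 - 1 / P) * volume Q.set ^ (1 - 1 / P))
      = ((volume Q.set)⁻¹ * u * (u' / u) * volume Q.set) ^ (1 / P) *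
        (mean (E.indicator 1) Q ^ (1 - 1 / P) * volume Q.set ^ (1 - 1 / P)) := by rw [← hu]
    _ = ((volume Q.set)⁻¹ * u) ^ (1 / P) * (u' / u) ^ (1 / P) *
        (mean (E.indicator 1) Q ^ (1 - 1 / P) *
          (volume Q.set ^ (1 / P) * volume Q.set ^ (1 - 1 / P))) := by
      rw [ENNReal.mul_rpow_of_nonneg _ _ hP0, ENNReal.mul_rpow_of_nonneg _ _ hP0]
      ring
    _ = _ := by rw [← hvol]

theorem aemeasurable_prodW {w : Fin m → Rd d → ℝ} (hw : ∀ j, IsWeight (w j)) :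
    AEMeasurable (prodW w) :=
  Finset.aemeasurable_fun_prod _ fun j _ => (hw j).1.aestronglyMeasurable.aemeasurable

theorem prodW_pos {w : Fin m → Rd d → ℝ} (hw : ∀ j, IsWeight (w j)) :
    ∀ᵐ x ∂(volume : Measure (Rd d)), 0 < prodW w x := by
  filter_upwards [ae_all_iff.2 fun j => (hw j).2] with x hx
  exact Finset.prod_pos fun j _ => hx j

theorem avgE_ne_zero {v : Rd d → ℝ} (hv : AEMeasurable v)
    (h0 : ∀ᵐ x ∂(volume : Measure (Rd d)), v x ≠ 0) {q : ℝ≥0∞} (hq : q ≠ 0) (Q : Cube d) :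
    avgE v q Q ≠ 0 := by
  rw [avgE_eq_eLpNorm _ hq, Ne, eLpNorm_eq_zero_iff (hv.mono_ac Q.prob_ac).aestronglyMeasurable hq]
  intro h
  have : (ae Q.prob).NeBot := ae_neBot.2 Q.prob_ne_zero
  obtain ⟨x, hx, hx'⟩ := (h.and (Q.prob_ac.ae_le h0)).exists
  exact hx' hx

theorem avgE_inv_weight_ne_zero {u : Rd d → ℝ} (hu : IsWeight u) (q : ℝ≥0∞) (Q : Cube d) :
    avgE (fun x => (u x)⁻¹) (conj q) Q ≠ 0 :=
  avgE_ne_zero hu.1.aestronglyMeasurable.aemeasurable.inv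
    (hu.2.mono fun _ hx => (inv_pos.2 hx).ne') conj_ne_zero Q

theorem avg_prodW_ne_zero {w : Fin m → Rd d → ℝ} (hw : ∀ j, IsWeight (w j)) {q : ℝ≥0∞}
    (hq : 1 ≤ q) (hqt : q ≠ ∞) (Q : Cube d) : avg (prodW w) q.toReal Q ≠ 0 := by
  have h := avgE_ne_zero (aemeasurable_prodW hw) ((prodW_pos hw).mono fun _ hx => hx.ne')
    (q := q) (by positivity) Q
  rwa [avgE, if_neg hqt] at h

theorem avg_mul_prod_le_AP (p0 : ℝ) (p : Fin m → ℝ≥0∞) (w : Fin m → Rd d → ℝ) (Q : Cube d) :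
    avg (prodW w) p0 Q * ∏ j, avgE (fun x => (w j x)⁻¹) (conj (p j)) Q ≤ AP p0 p w :=
  le_iSup (fun Q => avg (prodW w) p0 Q * ∏ j, avgE (fun x => (w j x)⁻¹) (conj (p j)) Q) Q

theorem prod_avgE_ne_zero {w : Fin m → Rd d → ℝ} (hw : ∀ j, IsWeight (w j)) (p : Fin m → ℝ≥0∞)
    (Q : Cube d) : ∏ j, avgE (fun x => (w j x)⁻¹) (conj (p j)) Q ≠ 0 :=
  Finset.prod_ne_zero_iff.2 fun j _ => avgE_inv_weight_ne_zero (hw j) (p j) Q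

theorem avg_prodW_ne_top {w : Fin m → Rd d → ℝ} (hw : ∀ j, IsWeight (w j)) {p0 : ℝ}
    {p : Fin m → ℝ≥0∞} (hA : AP p0 p w ≠ ∞) (Q : Cube d) : avg (prodW w) p0 Q ≠ ∞ := by
  intro h
  have := avg_mul_prod_le_AP p0 p w Q
  rw [h, ENNReal.top_mul (prod_avgE_ne_zero hw p Q), top_le_iff] at this
  exact hA this

/-- The unit cube. -/
def unitCube (d : ℕ) : Cube d := ⟨0, 1, one_pos⟩

theorem AP_ne_zero {w : Fin m → Rd d → ℝ} (hw : ∀ j, IsWeight (w j)) {p0 : ℝ≥0∞}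
    (hp0 : 1 ≤ p0) (hp0t : p0 ≠ ∞) (p : Fin m → ℝ≥0∞) : AP p0.toReal p w ≠ 0 := by
  intro h
  have h1 := avg_mul_prod_le_AP p0.toReal p w (unitCube d)
  rw [h, nonpos_iff_eq_zero, mul_eq_zero] at h1
  exact h1.elim (avg_prodW_ne_zero hw hp0 hp0t _) (prod_avgE_ne_zero hw p _)

theorem avg_eq_mean_rpow (u : Rd d → ℝ) (P : ℝ) (Q : Cube d) :
    avg u P Q = mean (fun x => ofFn u x ^ P) Q ^ (1 / P) := rfl

theorem setLIntegral_ne_zero_of_avg {u : Rd d → ℝ} {P : ℝ} (hP : 0 < P) {Q : Cube d}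
    (h : avg u P Q ≠ 0) : ∫⁻ x in Q.set, ofFn u x ^ P ≠ 0 := by
  contrapose! h
  rw [avg_eq_mean_rpow, mean, h, mul_zero, ENNReal.zero_rpow_of_pos (by positivity)]

theorem setLIntegral_ne_top_of_avg {u : Rd d → ℝ} {P : ℝ} (hP : 0 < P) {Q : Cube d}
    (h : avg u P Q ≠ ∞) : ∫⁻ x in Q.set, ofFn u x ^ P ≠ ∞ := by
  contrapose! h
  rw [avg_eq_mean_rpow, mean, h, ENNReal.mul_top Q.inv_volume_ne_zero,
    ENNReal.top_rpow_of_pos (by positivity)]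

theorem mean_congr {U V : Rd d → ℝ≥0∞} (h : U =ᵐ[volume] V) (Q : Cube d) :
    mean U Q = mean V Q := by
  rw [mean, mean, lintegral_congr_ae (ae_restrict_of_ae h)]

theorem localMax_congr {U V : Rd d → ℝ≥0∞} (h : U =ᵐ[volume] V) (Q : Cube d) :
    localMax U Q = localMax V Q := by
  ext x
  simp only [localMax]
  refine iSup_congr fun P => iSup_congr fun _ => mean_congr ?_ P
  filter_upwards [h] with y hy
  simp only [indicator, hy]

theorem maximal_indicator (W : Rd d → ℝ) (Q : Cube d) (x : Rd d) :
    maximal (Q.set.indicator W) x = localMax (ofFn W) Q x := by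
  have : ofFn (Q.set.indicator W) = Q.set.indicator (ofFn W) := by
    ext y
    by_cases hy : y ∈ Q.set <;> simp [ofFn, hy]
  simp only [maximal, localMax, avg_one, this]

theorem ofFn_rpow_ae {u : Rd d → ℝ} (hu : ∀ᵐ x ∂(volume : Measure (Rd d)), 0 < u x) (P : ℝ) :
    (ofFn fun x => u x ^ P) =ᵐ[volume] fun x => ofFn u x ^ P := by
  filter_upwards [hu] with x hx
  simp only [ofFn]
  rw [abs_of_pos hx, abs_of_pos (Real.rpow_pos_of_pos hx P), ENNReal.ofReal_rpow_of_pos hx]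

theorem wMeas_rpow {u : Rd d → ℝ} (hu : ∀ᵐ x ∂(volume : Measure (Rd d)), 0 < u x) (P : ℝ)
    (A : Set (Rd d)) : wMeas (fun x => u x ^ P) A = ∫⁻ x in A, ofFn u x ^ P := by
  refine lintegral_congr_ae (ae_restrict_of_ae ?_)
  filter_upwards [hu] with x hx
  simp only [ofFn]
  rw [abs_of_pos hx, ENNReal.ofReal_rpow_of_pos hx]

theorem setLIntegral_localMax_le_FW {u : Rd d → ℝ}
    (hu : ∀ᵐ x ∂(volume : Measure (Rd d)), 0 < u x) {P : ℝ} {Q : Cube d}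
    (h0 : ∫⁻ x in Q.set, ofFn u x ^ P ≠ 0) (ht : ∫⁻ x in Q.set, ofFn u x ^ P ≠ ∞) :
    ∫⁻ x in Q.set, localMax (fun x => ofFn u x ^ P) Q x ≤
      FW (fun x => u x ^ P) * ∫⁻ x in Q.set, ofFn u x ^ P := by
  have h : (wMeas (fun x => u x ^ P) Q.set)⁻¹ *
      ∫⁻ x in Q.set, maximal (Q.set.indicator fun x => u x ^ P) x ≤ FW (fun x => u x ^ P) :=
    le_iSup (fun Q : Cube d => (wMeas (fun x => u x ^ P) Q.set)⁻¹ *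
      ∫⁻ x in Q.set, maximal (Q.set.indicator fun x => u x ^ P) x) Q
  simp only [maximal_indicator, localMax_congr (ofFn_rpow_ae hu P), wMeas_rpow hu] at h
  rw [mul_comm, ← div_eq_mul_inv] at h
  exact (ENNReal.div_le_iff h0 ht).1 h

theorem one_le_FW {w : Fin m → Rd d → ℝ} (hw : ∀ j, IsWeight (w j)) {p0 : ℝ≥0∞} (hp0 : 1 ≤ p0)
    (hp0t : p0 ≠ ∞) {p : Fin m → ℝ≥0∞} (hA : AP p0.toReal p w ≠ ∞) :
    1 ≤ FW (fun x => prodW w x ^ p0.toReal) := by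
  have hP : 0 < p0.toReal := ENNReal.toReal_pos (by positivity) hp0t
  set Q := unitCube d
  set U : Rd d → ℝ≥0∞ := fun x => ofFn (prodW w) x ^ p0.toReal
  have h0 : ∫⁻ x in Q.set, U x ≠ 0 :=
    setLIntegral_ne_zero_of_avg hP (avg_prodW_ne_zero hw hp0 hp0t Q)
  have ht : ∫⁻ x in Q.set, U x ≠ ∞ := setLIntegral_ne_top_of_avg hP (avg_prodW_ne_top hw hA Q)
  have h1 : ∫⁻ x in Q.set, U x ≤ ∫⁻ x in Q.set, localMax U Q x := by
    calc ∫⁻ x in Q.set, U x = ∫⁻ _ in Q.set, mean U Q := by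
          rw [setLIntegral_const, mean_mul_volume]
      _ ≤ _ := setLIntegral_mono' Q.measurableSet fun x hx => mean_le_localMax hx Subset.rfl
  rw [← ENNReal.mul_le_mul_iff_left h0 ht, one_mul]
  exact h1.trans (setLIntegral_localMax_le_FW (prodW_pos hw) h0 ht)

/-- The sum of the normalised densities of the `f j` and of the indicator of `G`. -/
def totalDensity (f : Fin m → Rd d → ℝ) (p : Fin m → ℝ≥0∞) (G : Set (Rd d)) (x : Rd d) : ℝ≥0∞ :=
  ∑ j, density (f j) (p j) x + (volume G)⁻¹ * G.indicator 1 x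

theorem lintegral_totalDensity_eq {f : Fin m → Rd d → ℝ} (hf : ∀ j, AEMeasurable (f j))
    (p : Fin m → ℝ≥0∞) {G : Set (Rd d)} (hG : MeasurableSet G) {μ : Measure (Rd d)}
    (hμ : μ ≪ volume) :
    ∫⁻ x, totalDensity f p G x ∂μ =
      ∑ j, ∫⁻ x, density (f j) (p j) x ∂μ + (volume G)⁻¹ * μ G := by
  have hd : ∀ j, AEMeasurable (density (f j) (p j)) μ := by
    intro j
    by_cases h : p j = ∞
    · unfold density
      simp only [if_pos h]
      exact aemeasurable_const
    · unfold density
      simp only [if_neg h, ofFn_eq_enorm]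
      exact (((hf j).mono_ac hμ).enorm.div_const _).pow_const _
  simp only [totalDensity]
  rw [lintegral_add_right _ ((measurable_one.indicator hG).const_mul _),
    lintegral_finsetSum' _ fun j _ => hd j, lintegral_const_mul _ (measurable_one.indicator hG),
    lintegral_indicator_one hG]

theorem lintegral_totalDensity_le {f : Fin m → Rd d → ℝ} (hf : ∀ j, AEMeasurable (f j))
    {p : Fin m → ℝ≥0∞} (hp : ∀ j, 1 ≤ p j) (h0 : ∀ j, eLpNorm (f j) (p j) volume ≠ 0)
    {G : Set (Rd d)} (hG : MeasurableSet G) :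
    ∫⁻ x, totalDensity f p G x ≤ m + 1 := by
  rw [lintegral_totalDensity_eq hf p hG Measure.AbsolutelyContinuous.rfl]
  refine add_le_add ?_ ?_
  · calc ∑ j, ∫⁻ x, density (f j) (p j) x ≤ ∑ _j : Fin m, 1 :=
        Finset.sum_le_sum fun j _ => lintegral_density_le (hp j) (h0 j)
      _ = m := by simp
  · rw [mul_comm]
    exact ENNReal.mul_inv_le_one _

theorem prod_avg_le {f w : Fin m → Rd d → ℝ} (hf : ∀ j, AEMeasurable (f j))
    (hw : ∀ j, IsWeight (w j)) {p : Fin m → ℝ≥0∞} (hp : ∀ j, 1 ≤ p j)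
    (h0 : ∀ j, eLpNorm (f j) (p j) volume ≠ 0) (ht : ∀ j, eLpNorm (f j) (p j) volume ≠ ∞)
    {p0 : ℝ≥0∞} (hp0 : p0⁻¹ = ∑ j, (p j)⁻¹) (Q : Cube d) :
    ∏ j, avg (fun x => f j x * (w j x)⁻¹) 1 Q ≤
      (∏ j, eLpNorm (f j) (p j) volume) *
        ((∑ j, mean (density (f j) (p j)) Q) ^ (1 / p0.toReal) *
          ∏ j, avgE (fun x => (w j x)⁻¹) (conj (p j)) Q) := by
  have hsum : 1 / p0.toReal = ∑ j, ((p j)⁻¹).toReal := by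
    rw [← ENNReal.toReal_sum fun j _ => ENNReal.inv_ne_top.2 (by have := hp j; positivity), ← hp0,
      ENNReal.toReal_inv, one_div]
  calc ∏ j, avg (fun x => f j x * (w j x)⁻¹) 1 Q
      ≤ ∏ j, eLpNorm (f j) (p j) volume * (mean (density (f j) (p j)) Q ^ ((p j)⁻¹).toReal *
          avgE (fun x => (w j x)⁻¹) (conj (p j)) Q) := by
        refine Finset.prod_le_prod' fun j _ => ?_
        rw [avg_one, ← mul_assoc]
        exact (mean_mul_le (hf j) (hw j).1.aestronglyMeasurable.aemeasurable.inv (hp j) Q).trans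
          (mul_le_mul_left (eLpNorm_prob_le (hp j) (h0 j) (ht j) Q) _)
    _ ≤ _ := by
        rw [Finset.prod_mul_distrib, Finset.prod_mul_distrib, hsum]
        gcongr
        exact prod_rpow_le_sum_rpow _ _ _ fun _ _ => ENNReal.toReal_nonneg

theorem sparse_term_le {f w : Fin m → Rd d → ℝ} (hf : ∀ j, AEMeasurable (f j))
    (hw : ∀ j, IsWeight (w j)) {p : Fin m → ℝ≥0∞} (hp : ∀ j, 1 ≤ p j)
    (h0 : ∀ j, eLpNorm (f j) (p j) volume ≠ 0) (ht : ∀ j, eLpNorm (f j) (p j) volume ≠ ∞)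
    {p0 : ℝ≥0∞} (hp0ge : 1 ≤ p0) (hp0t : p0 ≠ ∞) (hp0 : p0⁻¹ = ∑ j, (p j)⁻¹)
    (hA : AP p0.toReal p w ≠ ∞) {u : Rd d → ℝ} (hu : u =ᵐ[volume] prodW w)
    {E G : Set (Rd d)} (hE : MeasurableSet E) (hG : MeasurableSet G) (hEG : E ⊆ G)
    (hG0 : volume G ≠ 0) (hGt : volume G ≠ ∞) (Q : Cube d) :
    (∏ j, avg (fun x => f j x * (w j x)⁻¹) 1 Q) * avg (E.indicator u) 1 Q * volume Q.set ≤
      (∏ j, eLpNorm (f j) (p j) volume) * AP p0.toReal p w *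
        volume G ^ (1 - 1 / p0.toReal) *
          (((∫⁻ x in E ∩ Q.set, ofFn (prodW w) x ^ p0.toReal) /
            ∫⁻ x in Q.set, ofFn (prodW w) x ^ p0.toReal) ^ (1 / p0.toReal) *
              ∫⁻ x in Q.set, totalDensity f p G x) := by
  set P := p0.toReal with hPdef
  have hP : 1 ≤ P := by
    rw [hPdef, ← ENNReal.toReal_one]
    exact ENNReal.toReal_mono hp0t hp0ge
  have hP0 : 0 ≤ 1 / P := by positivity
  have hP1 : 0 ≤ 1 - 1 / P := by
    rw [sub_nonneg]
    exact (div_le_one (by linarith)).2 hP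
  set h := mean (totalDensity f p G) Q with hh
  have hsplit : h = ∑ j, mean (density (f j) (p j)) Q +
      (volume G)⁻¹ * mean (G.indicator 1) Q := by
    rw [hh, ← lintegral_prob, lintegral_totalDensity_eq hf p hG Q.prob_ac]
    simp only [lintegral_prob]
    rw [← lintegral_indicator_one (μ := Q.prob) hG, lintegral_prob]
  have hγ : mean (E.indicator 1) Q ≤ volume G * h := by
    calc mean (E.indicator 1) Q ≤ mean (G.indicator 1) Q := by
          rw [mean, mean]
          gcongr
      _ = volume G * ((volume G)⁻¹ * mean (G.indicator 1) Q) := by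
          rw [← mul_assoc, ENNReal.mul_inv_cancel hG0 hGt, one_mul]
      _ ≤ _ := by
          rw [hsplit]
          gcongr
          exact le_add_self
  have hu' : avg (E.indicator u) 1 Q * volume Q.set = ∫⁻ x in E ∩ Q.set, ofFn (prodW w) x := by
    rw [avg_one, mean_mul_volume, ← setLIntegral_indicator hE]
    refine lintegral_congr_ae (ae_restrict_of_ae ?_)
    filter_upwards [hu] with x hx
    by_cases hxE : x ∈ E <;> simp [ofFn, hxE, hx]
  have hlast := setLIntegral_ofFn_le_avg (aemeasurable_prodW hw) hP hE (Q := Q)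
    (setLIntegral_ne_zero_of_avg (by linarith) (avg_prodW_ne_zero hw hp0ge hp0t Q))
    (setLIntegral_ne_top_of_avg (by linarith) (avg_prodW_ne_top hw hA Q))
  rw [mul_assoc, hu']
  refine (mul_le_mul' (prod_avg_le hf hw hp h0 ht hp0 Q) hlast).trans ?_
  rw [← hPdef]
  set R := ((∫⁻ x in E ∩ Q.set, ofFn (prodW w) x ^ P) /
    ∫⁻ x in Q.set, ofFn (prodW w) x ^ P) ^ (1 / P)
  set s := ∑ j, mean (density (f j) (p j)) Q
  have hcomb : s ^ (1 / P) * mean (E.indicator 1) Q ^ (1 - 1 / P) ≤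
      volume G ^ (1 - 1 / P) * h := by
    calc s ^ (1 / P) * mean (E.indicator 1) Q ^ (1 - 1 / P)
        ≤ h ^ (1 / P) * (volume G * h) ^ (1 - 1 / P) := by
          refine mul_le_mul' (ENNReal.rpow_le_rpow ?_ hP0) (ENNReal.rpow_le_rpow hγ hP1)
          rw [hsplit]
          exact le_self_add
      _ = volume G ^ (1 - 1 / P) * (h ^ (1 / P) * h ^ (1 - 1 / P)) := by
          rw [ENNReal.mul_rpow_of_nonneg _ _ hP1]
          ring
      _ = _ := by
          rw [← ENNReal.rpow_add_of_nonneg _ _ hP0 hP1]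
          simp
  calc _ = (∏ j, eLpNorm (f j) (p j) volume) *
        (avg (prodW w) P Q * ∏ j, avgE (fun x => (w j x)⁻¹) (conj (p j)) Q) *
        (s ^ (1 / P) * mean (E.indicator 1) Q ^ (1 - 1 / P)) * (R * volume Q.set) := by ring
    _ ≤ (∏ j, eLpNorm (f j) (p j) volume) * AP P p w * (volume G ^ (1 - 1 / P) * h) *
        (R * volume Q.set) := by
        gcongr
        exact avg_mul_prod_le_AP P p w Q
    _ = _ := by
        rw [← mean_mul_volume (totalDensity f p G) Q]
        ring

theorem exists_major_subset (hd : 1 ≤ d) {H : Rd d → ℝ≥0∞} {B : ℝ≥0∞} (hH : ∫⁻ x, H x ≤ B)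
    (hB0 : B ≠ 0) (hBt : B ≠ ∞) {G : Set (Rd d)} (hG : MeasurableSet G) (hG0 : volume G ≠ 0)
    (hGt : volume G ≠ ∞) :
    ∃ E ⊆ G, MeasurableSet E ∧ volume G ≤ 2 * volume E ∧ ∀ Q : Cube d,
      volume (E ∩ Q.set) ≠ 0 →
        ∫⁻ x in Q.set, H x ≤ 2 * 5 ^ d * B / volume G * volume Q.set := by
  have hK0 : (2 * 5 ^ d * B : ℝ≥0∞) ≠ 0 := by positivity
  have hKt : (2 * 5 ^ d * B : ℝ≥0∞) ≠ ∞ :=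
    ENNReal.mul_ne_top (ENNReal.mul_ne_top (by simp) (ENNReal.pow_ne_top (by simp))) hBt
  set c := 2 * 5 ^ d * B / volume G with hc
  have hc0 : c ≠ 0 := ENNReal.div_ne_zero.2 ⟨hK0, hGt⟩
  have hct : c ≠ ∞ := ENNReal.div_ne_top hKt hG0
  set F : Set (Cube d) := {Q | c * volume Q.set < ∫⁻ x in Q.set, H x} with hF
  have hside : ∀ Q ∈ F, Q.side ≤ max 1 (B / c).toReal := by
    intro Q hQ
    rcases le_total Q.side 1 with h | h
    · exact h.trans (le_max_left _ _)
    · refine le_trans ?_ (le_max_right _ _)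
      have h1 : volume Q.set ≤ B / c := by
        rw [ENNReal.le_div_iff_mul_le (Or.inl hc0) (Or.inl hct), mul_comm]
        exact (le_of_lt hQ).trans ((setLIntegral_le_lintegral _ _).trans hH)
      rw [Q.volume_eq, ← ENNReal.ofReal_pow Q.side_pos.le,
        ENNReal.ofReal_le_iff_le_toReal (ENNReal.div_ne_top hBt hc0)] at h1
      exact (le_self_pow₀ h (by lia)).trans h1
  set V := ⋃ Q ∈ F, Q.set with hV
  have hcV : c * volume V ≤ 5 ^ d * B :=
    (mul_volume_iUnion_cube_le F _ hside H c fun Q hQ => le_of_lt hQ).trans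
      (mul_le_mul_right ((setLIntegral_le_lintegral _ _).trans hH) _)
  have hVG : 2 * volume V ≤ volume G := by
    have h1 : c * (2 * volume V) ≤ c * volume G := by
      calc c * (2 * volume V) = 2 * (c * volume V) := by ring
        _ ≤ 2 * (5 ^ d * B) := by gcongr
        _ = c * volume G := by rw [hc, ENNReal.div_mul_cancel hG0 hGt]; ring
    exact (ENNReal.mul_le_mul_iff_right hc0 hct).1 h1
  refine ⟨G \ toMeasurable volume V, sdiff_subset, hG.diff (measurableSet_toMeasurable _ _), ?_, ?_⟩
  · have h1 : volume G ≤ volume V + volume (G \ toMeasurable volume V) := by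
      rw [← measure_toMeasurable V]
      calc volume G ≤ volume (toMeasurable volume V ∪ G \ toMeasurable volume V) := by
            refine measure_mono ?_
            rw [union_sdiff_self]
            exact subset_union_right
        _ ≤ _ := measure_union_le _ _
    have h2 : volume G + volume G ≤ volume G + 2 * volume (G \ toMeasurable volume V) := by
      calc volume G + volume G = 2 * volume G := (two_mul _).symm
        _ ≤ 2 * (volume V + volume (G \ toMeasurable volume V)) := by gcongr
        _ = 2 * volume V + 2 * volume (G \ toMeasurable volume V) := mul_add _ _ _
        _ ≤ _ := by gcongr
    exact (ENNReal.add_le_add_iff_left hGt).1 h2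
  · intro Q hQ
    by_contra! h
    refine hQ (measure_mono_null ?_ measure_empty)
    rintro x ⟨hx, hxQ⟩
    exact hx.2 (subset_toMeasurable _ _ (mem_iUnion₂.2 ⟨Q, h, hxQ⟩))

theorem weak_le_of_dual {T w : Rd d → ℝ} (hT : Measurable T) (hw : Measurable w) {P : ℝ}
    (hP : 1 ≤ P) {Y : ℝ≥0∞}
    (h : ∀ G, MeasurableSet G → Bornology.IsBounded G → (∃ N, ∀ x ∈ G, |w x| ≤ N) →
      volume G ≠ 0 → ∃ E ⊆ G, MeasurableSet E ∧ volume G ≤ 2 * volume E ∧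
        ∫⁻ x, ofFn T x * ofFn (E.indicator w) x ≤ Y * volume G ^ (1 - 1 / P))
    {l : ℝ} (hl : 0 < l) :
    ENNReal.ofReal l * volume {x | ENNReal.ofReal l < ofFn T x * ENNReal.ofReal (w x)} ^ (1 / P) ≤
      2 * Y := by
  have hP0 : 0 ≤ 1 / P := by positivity
  have hP1 : 0 ≤ 1 - 1 / P := by
    rw [sub_nonneg]
    exact (div_le_one (by linarith)).2 hP
  have hl0 : ENNReal.ofReal l ≠ 0 := by simpa using hl
  set S := {x | ENNReal.ofReal l < ofFn T x * ENNReal.ofReal (w x)} with hS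
  have hTm : Measurable (ofFn T) := by
    rw [ofFn_eq_enorm]
    exact hT.enorm
  have hSm : MeasurableSet S := measurableSet_lt measurable_const (hTm.mul hw.ennreal_ofReal)
  let A : ℕ → Set (Rd d) := fun n => S ∩ Metric.closedBall 0 n ∩ {x | |w x| ≤ n}
  have hAm : ∀ n, MeasurableSet (A n) := fun n =>
    (hSm.inter measurableSet_closedBall).inter (measurableSet_le hw.abs measurable_const)
  have hmono : Monotone A := by
    rintro a b hab x ⟨⟨h1, h2⟩, h3⟩
    have : (a : ℝ) ≤ b := by exact_mod_cast hab
    exact ⟨⟨h1, Metric.closedBall_subset_closedBall this h2⟩, le_trans h3 this⟩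
  have hU : ⋃ n, A n = S := by
    refine Subset.antisymm (iUnion_subset fun n x hx => hx.1.1) fun x hx => ?_
    obtain ⟨n, hn⟩ := exists_nat_ge (max (dist x 0) |w x|)
    exact mem_iUnion.2 ⟨n, ⟨hx, (le_max_left _ _).trans hn⟩, (le_max_right _ _).trans hn⟩
  have hiff : ∀ a : ℝ≥0∞, ENNReal.ofReal l * a ^ (1 / P) ≤ 2 * Y ↔
      a ≤ (2 * Y / ENNReal.ofReal l) ^ P := by
    intro a
    rw [← ENNReal.rpow_inv_le_iff (by linarith), ← one_div,
      ENNReal.le_div_iff_mul_le (Or.inl hl0) (Or.inl ENNReal.ofReal_ne_top), mul_comm]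
  rw [hiff, ← hU, hmono.measure_iUnion]
  refine iSup_le fun n => (hiff _).1 ?_
  by_cases hG0 : volume (A n) = 0
  · rw [hG0, ENNReal.zero_rpow_of_pos (by positivity), mul_zero]
    exact zero_le
  have hbdd : Bornology.IsBounded (A n) :=
    Metric.isBounded_closedBall.subset fun x hx => hx.1.2
  have hGt : volume (A n) ≠ ∞ := hbdd.measure_lt_top.ne
  obtain ⟨E, hEG, hE, hGE, hYE⟩ := h (A n) (hAm n) hbdd ⟨n, fun x hx => hx.2⟩ hG0
  have hlE : ENNReal.ofReal l * volume E ≤ Y * volume (A n) ^ (1 - 1 / P) := by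
    refine le_trans ?_ hYE
    rw [← setLIntegral_const]
    refine le_trans (setLIntegral_mono' hE fun x hx => ?_) (setLIntegral_le_lintegral E _)
    rw [ofFn, ofFn, indicator_of_mem hx]
    refine (le_of_lt (hEG hx).1.1).trans ?_
    gcongr
    · exact le_rfl
    · exact le_abs_self _
  have hpow : volume (A n) = volume (A n) ^ (1 / P) * volume (A n) ^ (1 - 1 / P) := by
    rw [← ENNReal.rpow_add_of_nonneg _ _ hP0 hP1]
    simp
  rw [← ENNReal.mul_le_mul_iff_left (ENNReal.rpow_pos (pos_iff_ne_zero.2 hG0) hGt).ne'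
    (ENNReal.rpow_ne_top_of_nonneg hP1 hGt)]
  calc _ = ENNReal.ofReal l * volume (A n) := by rw [mul_assoc, ← hpow]
    _ ≤ ENNReal.ofReal l * (2 * volume E) := by gcongr
    _ = 2 * (ENNReal.ofReal l * volume E) := by ring
    _ ≤ 2 * (Y * volume (A n) ^ (1 - 1 / P)) := by gcongr
    _ = _ := by ring

theorem sparseForm_eq_zero {v : Fin m → Rd d → ℝ} {j : Fin m} (hj : v j =ᵐ[volume] 0)
    (S : Set (Cube d)) (g : Rd d → ℝ) : sparseForm S v g = 0 := by
  refine ENNReal.tsum_eq_zero.2 fun Q => ?_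
  have h : avg (v j) 1 Q.1 = 0 := by
    rw [avg_one, mean_congr (V := fun _ => 0)]
    · simp [mean]
    · filter_upwards [hj] with x hx
      simp [ofFn, hx]
  rw [Finset.prod_eq_zero (Finset.mem_univ j) h, zero_mul, zero_mul]

theorem sparseForm_le_of_forall_finset {v : Fin m → Rd d → ℝ} {g : Rd d → ℝ} {S : Set (Cube d)}
    {K : ℝ≥0∞} (h : ∀ F : Finset (Cube d), (∀ Q ∈ F, Q ∈ S) →
      ∑ Q ∈ F, (∏ j, avg (v j) 1 Q) * avg g 1 Q * volume Q.set ≤ K) :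
    sparseForm S v g ≤ K := by
  rw [sparseForm, ENNReal.tsum_eq_iSup_sum]
  refine iSup_le fun t => ?_
  have := h (t.map (Function.Embedding.subtype _)) fun Q hQ => by
    obtain ⟨R, -, rfl⟩ := Finset.mem_map.1 hQ
    exact R.2
  rwa [Finset.sum_map] at this

theorem exists_nat_between {a : ℝ≥0∞} (ha : a ≠ ∞) : ∃ J : ℕ, a ≤ J ∧ (J : ℝ≥0∞) ≤ a + 1 := by
  refine ⟨⌈a.toReal⌉₊, ?_, ?_⟩
  · conv_lhs => rw [← ENNReal.ofReal_toReal ha]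
    rw [← ENNReal.ofReal_natCast]
    exact ENNReal.ofReal_le_ofReal (Nat.le_ceil _)
  · conv_rhs => rw [← ENNReal.ofReal_toReal ha, ← ENNReal.ofReal_one,
      ← ENNReal.ofReal_add ENNReal.toReal_nonneg zero_le_one]
    rw [← ENNReal.ofReal_natCast]
    exact ENNReal.ofReal_le_ofReal (Nat.ceil_lt_add_one ENNReal.toReal_nonneg).le

theorem aemeasurable_of_mul_inv {f u : Rd d → ℝ} (hu : IsWeight u)
    (h : Measurable fun x => f x * (u x)⁻¹) : AEMeasurable f := by
  refine (h.aemeasurable.mul hu.1.aestronglyMeasurable.aemeasurable).congr ?_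
  filter_upwards [hu.2] with x hx
  simp [mul_assoc, inv_mul_cancel₀ hx.ne']

theorem weak_le_of_sparseForm_le {T : (Fin m → Rd d → ℝ) → Rd d → ℝ}
    (hT : ∀ f, Measurable (T f)) {CT : ℝ≥0∞} (hdom : SparseFormDom T CT)
    {v : Fin m → Rd d → ℝ} (hv : ∀ j, BCS (v j)) {w : Rd d → ℝ} (hw : AEMeasurable w)
    {P : ℝ} (hP : 1 ≤ P) {Y : ℝ≥0∞}
    (h : ∀ G, MeasurableSet G → volume G ≠ 0 → volume G ≠ ∞ →
      ∃ E ⊆ G, MeasurableSet E ∧ volume G ≤ 2 * volume E ∧ ∀ S, IsSparse (1 / 2) S →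
        sparseForm S v (E.indicator (hw.mk w)) ≤ Y * volume G ^ (1 - 1 / P))
    {l : ℝ} (hl : 0 < l) :
    ENNReal.ofReal l *
      volume {x | ENNReal.ofReal l < ofFn (T v) x * ENNReal.ofReal (w x)} ^ (1 / P) ≤
        2 * (CT * Y) := by
  have hset : volume {x | ENNReal.ofReal l < ofFn (T v) x * ENNReal.ofReal (w x)} =
      volume {x | ENNReal.ofReal l < ofFn (T v) x * ENNReal.ofReal (hw.mk w x)} := by
    refine measure_congr ?_
    filter_upwards [hw.ae_eq_mk] with x hx
    refine propext ?_
    change ENNReal.ofReal l < _ * ENNReal.ofReal (w x) ↔ ENNReal.ofReal l < _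
    rw [hx]
  rw [hset]
  refine weak_le_of_dual (hT v) hw.measurable_mk hP (fun G hG hGb hGN hG0 => ?_) hl
  obtain ⟨E, hEG, hE, hGE, hS⟩ := h G hG hG0 hGb.measure_lt_top.ne
  obtain ⟨N, hN⟩ := hGN
  refine ⟨E, hEG, hE, hGE, ?_⟩
  have hbcs : BCS (E.indicator (hw.mk w)) := by
    refine ⟨hw.measurable_mk.indicator hE, ⟨max N 0, fun x => ?_⟩, ?_⟩
    · by_cases hx : x ∈ E
      · rw [indicator_of_mem hx]
        exact (hN x (hEG hx)).trans (le_max_left _ _)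
      · simp [hx]
    · refine HasCompactSupport.of_support_subset_isCompact (hGb.isCompact_closure) ?_
      exact support_indicator_subset.trans (hEG.trans subset_closure)
  obtain ⟨S, hSs, hTS⟩ := hdom v _ hv hbcs
  refine hTS.trans ?_
  rw [mul_assoc]
  gcongr
  exact hS S hSs

theorem exists_major_subset_sparseForm_le (hd : 1 ≤ d) {f w : Fin m → Rd d → ℝ}
    (hf : ∀ j, AEMeasurable (f j)) (hw : ∀ j, IsWeight (w j)) {p : Fin m → ℝ≥0∞}
    (hp : ∀ j, 1 ≤ p j) (h0 : ∀ j, eLpNorm (f j) (p j) volume ≠ 0)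
    (ht : ∀ j, eLpNorm (f j) (p j) volume ≠ ∞) {p0 : ℝ≥0∞} (hp0ge : 1 ≤ p0) (hp0t : p0 ≠ ∞)
    (hp0 : p0⁻¹ = ∑ j, (p j)⁻¹) (hA : AP p0.toReal p w ≠ ∞)
    (hFW : FW (fun x => prodW w x ^ p0.toReal) ≠ ∞) {u : Rd d → ℝ} (hu : u =ᵐ[volume] prodW w)
    {G : Set (Rd d)} (hG : MeasurableSet G) (hG0 : volume G ≠ 0) (hGt : volume G ≠ ∞) :
    ∃ E ⊆ G, MeasurableSet E ∧ volume G ≤ 2 * volume E ∧ ∀ S, IsSparse (1 / 2) S →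
      sparseForm S (fun j x => f j x * (w j x)⁻¹) (E.indicator u) ≤
        4 * 25 ^ d * (m + 1) * (2 ^ (d + 2) + 3) * levelSeries (1 / p0.toReal) *
          FW (fun x => prodW w x ^ p0.toReal) * AP p0.toReal p w *
            (∏ j, eLpNorm (f j) (p j) volume) * volume G ^ (1 - 1 / p0.toReal) := by
  have hP : 0 < p0.toReal := ENNReal.toReal_pos (by positivity) hp0t
  set P := p0.toReal with hPdef
  set Λ := FW (fun x => prodW w x ^ P)
  have hU0 : ∀ Q : Cube d, ∫⁻ x in Q.set, ofFn (prodW w) x ^ P ≠ 0 := fun Q =>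
    setLIntegral_ne_zero_of_avg hP (avg_prodW_ne_zero hw hp0ge hp0t Q)
  have hUt : ∀ Q : Cube d, ∫⁻ x in Q.set, ofFn (prodW w) x ^ P ≠ ∞ := fun Q =>
    setLIntegral_ne_top_of_avg hP (avg_prodW_ne_top hw hA Q)
  have hΛ : ∀ Q : Cube d, ∫⁻ x in Q.set, localMax (fun x => ofFn (prodW w) x ^ P) Q x ≤
      Λ * ∫⁻ x in Q.set, ofFn (prodW w) x ^ P := fun Q =>
    setLIntegral_localMax_le_FW (prodW_pos hw) (hU0 Q) (hUt Q)
  have hΛ1 : 1 ≤ Λ := one_le_FW hw hp0ge hp0t hA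
  have hU : AEMeasurable fun x => ofFn (prodW w) x ^ P := by
    rw [ofFn_eq_enorm]
    exact (aemeasurable_prodW hw).enorm.pow_const _
  obtain ⟨J, hJ, hJ'⟩ := exists_nat_between
    (ENNReal.mul_ne_top (ENNReal.pow_ne_top ENNReal.ofNat_ne_top) hFW : 2 ^ (d + 2) * Λ ≠ ∞)
  have hJ0 : J ≠ 0 := by
    rintro rfl
    rw [Nat.cast_zero, nonpos_iff_eq_zero, mul_eq_zero] at hJ
    rcases hJ with h | h
    · exact absurd h (by positivity)
    · rw [h] at hΛ1
      exact absurd hΛ1 (by simp)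
  have hJΛ : (J : ℝ≥0∞) + 2 ≤ (2 ^ (d + 2) + 3) * Λ := by
    calc (J : ℝ≥0∞) + 2 ≤ 2 ^ (d + 2) * Λ + 1 + 2 := by gcongr
      _ = 2 ^ (d + 2) * Λ + 3 * 1 := by rw [add_assoc]; norm_num
      _ ≤ 2 ^ (d + 2) * Λ + 3 * Λ := by gcongr
      _ = _ := by ring
  have hH := lintegral_totalDensity_le hf hp h0 hG
  obtain ⟨E, hEG, hE, hGE, hup⟩ := exists_major_subset hd hH (by positivity) (by finiteness)
    hG hG0 hGt
  refine ⟨E, hEG, hE, hGE, fun S hS => sparseForm_le_of_forall_finset fun F hF => ?_⟩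
  have hcE : 2 * 5 ^ d * ((m : ℝ≥0∞) + 1) / volume G * volume E ≤ 2 * 5 ^ d * (m + 1) := by
    calc _ ≤ 2 * 5 ^ d * ((m : ℝ≥0∞) + 1) / volume G * volume G := by gcongr
      _ = _ := ENNReal.div_mul_cancel hG0 hGt
  calc ∑ Q ∈ F, (∏ j, avg (fun x => f j x * (w j x)⁻¹) 1 Q) * avg (E.indicator u) 1 Q *
        volume Q.set
      ≤ ∑ Q ∈ F, (∏ j, eLpNorm (f j) (p j) volume) * AP P p w * volume G ^ (1 - 1 / P) *
          (((∫⁻ x in E ∩ Q.set, ofFn (prodW w) x ^ P) /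
            ∫⁻ x in Q.set, ofFn (prodW w) x ^ P) ^ (1 / P) *
              ∫⁻ x in Q.set, totalDensity f p G x) := Finset.sum_le_sum fun Q _ =>
        sparse_term_le hf hw hp h0 ht hp0ge hp0t hp0 hA hu hE hG hEG hG0 hGt Q
    _ ≤ (∏ j, eLpNorm (f j) (p j) volume) * AP P p w * volume G ^ (1 - 1 / P) *
          (4 * 25 ^ d * (m + 1) * (J + 2) * levelSeries (1 / P)) := by
        rw [← Finset.mul_sum]
        gcongr
        exact hS.sum_rpow_mul_le hH hE hcE hup hU hU0 hUt hΛ hJ0 hJ (by positivity) F hF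
    _ ≤ (∏ j, eLpNorm (f j) (p j) volume) * AP P p w * volume G ^ (1 - 1 / P) *
          (4 * 25 ^ d * (m + 1) * ((2 ^ (d + 2) + 3) * Λ) * levelSeries (1 / P)) := by gcongr
    _ = _ := by ring

/-- Theorem B, case `p ≥ 1`: multiplier weak-type bound. -/
theorem stmt3 (d m : ℕ) (hd : 1 ≤ d) (hm : 1 ≤ m)
    (p : Fin m → ℝ≥0∞) (hp : ∀ j, 1 ≤ p j)
    (p0 : ℝ≥0∞) (hp0ge : 1 ≤ p0) (hp0top : p0 ≠ ∞) (hp0 : p0⁻¹ = ∑ j, (p j)⁻¹)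
    (CT : ℝ≥0∞) (hCT : CT ≠ ∞) :
    ∃ c : ℝ≥0∞, c ≠ ∞ ∧
      ∀ (T : (Fin m → Rd d → ℝ) → Rd d → ℝ),
        (∀ f, Measurable (T f)) → SparseFormDom T CT →
        ∀ w : Fin m → Rd d → ℝ, (∀ j, IsWeight (w j)) →
          AP p0.toReal p w ≠ ∞ →
          ∀ f : Fin m → Rd d → ℝ,
            (∀ j, BCS (fun x => f j x * (w j x)⁻¹)) →
            (⨆ (l : ℝ) (_ : 0 < l), ENNReal.ofReal l *
                (volume {x | ENNReal.ofReal l <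
                    ofFn (T (fun j x => f j x * (w j x)⁻¹)) x *
                      ENNReal.ofReal (prodW w x)}) ^ (1 / p0.toReal)) ≤
              c * FW (fun x => prodW w x ^ p0.toReal) * AP p0.toReal p w *
                ∏ j, eLpNorm (f j) (p j) volume := by
  have hP0 : 0 < p0.toReal := ENNReal.toReal_pos (by positivity) hp0top
  have hP : 1 ≤ p0.toReal := by
    rw [← ENNReal.toReal_one]
    exact ENNReal.toReal_mono hp0top hp0ge
  have hL := levelSeries_ne_top (α := 1 / p0.toReal) (by positivity)
  set K : ℝ≥0∞ := 4 * 25 ^ d * (m + 1) * (2 ^ (d + 2) + 3) * levelSeries (1 / p0.toReal)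
  have hK : K ≠ ∞ := by finiteness
  refine ⟨2 * (CT * K) + 1, by finiteness, fun T hT hdom w hw hA f hv => ?_⟩
  have hf : ∀ j, AEMeasurable (f j) := fun j => aemeasurable_of_mul_inv (hw j) (hv j).1
  refine iSup₂_le fun l hl => ?_
  by_cases h0 : ∃ j, eLpNorm (f j) (p j) volume = 0
  · obtain ⟨j, hj⟩ := h0
    rw [eLpNorm_eq_zero_iff (hf j).aestronglyMeasurable (by have := hp j; positivity)] at hj
    have := weak_le_of_sparseForm_le hT hdom hv (aemeasurable_prodW hw) hP (Y := 0)
      (fun G hG _ _ => ⟨G, Subset.rfl, hG, le_mul_of_one_le_left' one_le_two, fun S _ => by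
        rw [sparseForm_eq_zero (j := j)]
        · exact zero_le
        · filter_upwards [hj] with x hx
          simp [hx]⟩) hl
    refine this.trans ?_
    simp
  push Not at h0
  have hN0 : ∏ j, eLpNorm (f j) (p j) volume ≠ 0 := Finset.prod_ne_zero_iff.2 fun j _ => h0 j
  have hA0 := AP_ne_zero hw hp0ge hp0top p
  set Λ := FW (fun x => prodW w x ^ p0.toReal)
  have hΛ0 : Λ ≠ 0 := (zero_lt_one.trans_le (one_le_FW hw hp0ge hp0top hA)).ne'
  have hc0 : 2 * (CT * K) + 1 ≠ 0 := by positivity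
  by_cases hΛt : Λ = ∞
  · rw [hΛt, ENNReal.mul_top hc0, ENNReal.top_mul hA0, ENNReal.top_mul hN0]
    exact le_top
  by_cases ht : ∃ j, eLpNorm (f j) (p j) volume = ∞
  · obtain ⟨j, hj⟩ := ht
    rw [← Finset.mul_prod_erase _ _ (Finset.mem_univ j), hj,
      ENNReal.top_mul (Finset.prod_ne_zero_iff.2 fun i _ => h0 i), ENNReal.mul_top (mul_ne_zero (mul_ne_zero hc0 hΛ0) hA0)]
    exact le_top
  push Not at ht
  have hmain := weak_le_of_sparseForm_le hT hdom hv (aemeasurable_prodW hw) hP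
    (fun G hG hG0 hGt => exists_major_subset_sparseForm_le hd hf hw hp h0 ht hp0ge hp0top hp0 hA
      hΛt (aemeasurable_prodW hw).ae_eq_mk.symm hG hG0 hGt) hl
  refine hmain.trans ?_
  calc 2 * (CT * (K * Λ * AP p0.toReal p w * ∏ j, eLpNorm (f j) (p j) volume))
      = 2 * (CT * K) * Λ * AP p0.toReal p w * ∏ j, eLpNorm (f j) (p j) volume := by ring
    _ ≤ _ := by
        gcongr
        exact le_self_add

end Paper
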